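/- arXiv:2010.05643 — 8 statements merged into one kernel-verified Lean document; each statement's English description precedes it below -/
import Mathlib

section
/- Let r ≥ 1 be an integer and let T be a tournament with dichromatic number χ(T) ≥ 3r. Then T contains a strong K⃗_r minor, i.e. sm(T) ≥ r. -/
/-- A digraph on `V` is given by its adjacency relation `Adj` (loopless when
`Irreflexive Adj`).  `StronglyConnectedOn Adj S` says that the subdigraph of
the digraph induced by the vertex set `S` is strongly connected: for every
ordered pair of vertices of `S` there is a directed path inside `S` between
them. -/
def StronglyConnectedOn {V : Type} (Adj : V → V → Prop) (S : Set V) : Prop :=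
  ∀ ⦃u⦄, u ∈ S → ∀ ⦃v⦄, v ∈ S →
    Relation.ReflTransGen (fun a b => a ∈ S ∧ b ∈ S ∧ Adj a b) u v

/-- `S` is acyclic: the subdigraph induced by `S` contains no directed cycle. -/
def AcyclicOn {V : Type} (Adj : V → V → Prop) (S : Set V) : Prop :=
  ∀ v ∈ S, ¬ Relation.TransGen (fun a b => a ∈ S ∧ b ∈ S ∧ Adj a b) v v

/-- The subdigraph induced by `S` admits a partition of its vertex set into
`k` acyclic sets (a `k`-colouring). -/
def DiColorableOn {V : Type} (Adj : V → V → Prop) (S : Set V) (k : ℕ) : Prop :=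
  ∃ c : V → ℕ, (∀ v ∈ S, c v < k) ∧ ∀ i : ℕ, AcyclicOn Adj {v ∈ S | c v = i}

/-- The dichromatic number of the subdigraph induced by `S`: the least `k`
for which a `k`-colouring exists.  The dichromatic number of the whole
digraph is `dichromaticNumberOn Adj Set.univ`. -/
noncomputable def dichromaticNumberOn {V : Type} (Adj : V → V → Prop) (S : Set V) : ℕ :=
  sInf {k | DiColorableOn Adj S k}

/-- A tournament: a loopless digraph with exactly one directed edge between
any two distinct vertices. -/
def IsTournament {V : Type} (Adj : V → V → Prop) : Prop :=
  Irreflexive Adj ∧ ∀ u v : V, u ≠ v → (Adj u v ↔ ¬ Adj v u)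

/-- The digraph contains a strong `K⃗ r` minor: there are `r` pairwise
disjoint nonempty branch sets, each inducing a strongly connected
subdigraph, with at least one edge in each direction between any two
distinct branch sets. -/
def ContainsStrongCompleteMinor {V : Type} (Adj : V → V → Prop) (r : ℕ) : Prop :=
  ∃ X : Fin r → Set V,
    (∀ i, (X i).Nonempty) ∧
    (∀ i j, i ≠ j → Disjoint (X i) (X j)) ∧
    (∀ i, StronglyConnectedOn Adj (X i)) ∧
    (∀ i j, i ≠ j → ∃ u ∈ X i, ∃ v ∈ X j, Adj u v)

/-- Out-degree of a vertex. -/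
noncomputable def outDeg {V : Type} (Adj : V → V → Prop) (v : V) : ℕ :=
  {w | Adj v w}.ncard

/-- In-degree of a vertex. -/
noncomputable def inDeg {V : Type} (Adj : V → V → Prop) (v : V) : ℕ :=
  {w | Adj w v}.ncard

/-- The subdigraph induced by `W` is `k`-strongly-connected: it has at least
`k + 1` vertices and remains strongly connected after deleting any set of at
most `k - 1` vertices. -/
def KStronglyConnectedOn {V : Type} (Adj : V → V → Prop) (W : Set V) (k : ℕ) : Prop :=
  k + 1 ≤ W.ncard ∧
  ∀ S : Set V, S ⊆ W → S.ncard ≤ k - 1 → StronglyConnectedOn Adj (W \ S)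

namespace TMinor

abbrev RelOn {V : Type} (Adj : V → V → Prop) (S : Set V) : V → V → Prop :=
  fun a b => a ∈ S ∧ b ∈ S ∧ Adj a b

theorem relOn_mono {V : Type} {Adj : V → V → Prop} {S T : Set V} (h : S ⊆ T) (a b : V)
    (hab : RelOn Adj S a b) : RelOn Adj T a b := ⟨h hab.1, h hab.2.1, hab.2.2⟩

theorem acyclic_mono {V : Type} {Adj : V → V → Prop} {S T : Set V} (h : S ⊆ T)
    (hT : AcyclicOn Adj T) : AcyclicOn Adj S :=
  fun v hv hc => hT v (h hv) (Relation.TransGen.mono (relOn_mono h) _ _ hc)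

theorem acyclic_union {V : Type} {Adj : V → V → Prop} {A B : Set V}
    (hA : AcyclicOn Adj A) (hB : AcyclicOn Adj B)
    (hno : ∀ a ∈ A, ∀ b ∈ B, ¬ Adj a b) : AcyclicOn Adj (A ∪ B) := by
  have fwd : ∀ u v, Relation.TransGen (RelOn Adj (A ∪ B)) u v → u ∈ A →
      v ∈ A ∧ Relation.TransGen (RelOn Adj A) u v := by
    intro u v h hu
    induction h with
    | single h =>
      have := h.2.1.resolve_right (fun hb => hno _ hu _ hb h.2.2)
      exact ⟨this, .single ⟨hu, this, h.2.2⟩⟩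
    | tail _ h ih =>
      have := h.2.1.resolve_right (fun hb => hno _ ih.1 _ hb h.2.2)
      exact ⟨this, ih.2.tail ⟨ih.1, this, h.2.2⟩⟩
  have bwd : ∀ u v, Relation.TransGen (RelOn Adj (A ∪ B)) u v → v ∈ B →
      u ∈ B ∧ Relation.TransGen (RelOn Adj B) u v := by
    intro u v h hv
    induction h using Relation.TransGen.head_induction_on with
    | single h =>
      have := h.1.resolve_left (fun ha => hno _ ha _ hv h.2.2)
      exact ⟨this, .single ⟨this, hv, h.2.2⟩⟩
    | head h _ ih =>
      have := h.1.resolve_left (fun ha => hno _ ha _ ih.1 h.2.2)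
      exact ⟨this, .head ⟨this, ih.1, h.2.2⟩ ih.2⟩
  rintro v (hv | hv) hc
  · exact hA v hv (fwd v v hc hv).2
  · exact hB v hv (bwd v v hc hv).2

theorem acyclic_of_rank {V : Type} {Adj : V → V → Prop} {A : Set V} (f : V → ℕ)
    (h : ∀ a ∈ A, ∀ b ∈ A, Adj a b → f a < f b) : AcyclicOn Adj A := by
  have : ∀ u v, Relation.TransGen (RelOn Adj A) u v → f u < f v := by
    intro u v h'
    induction h' with
    | single h' => exact h _ h'.1 _ h'.2.1 h'.2.2
    | tail _ h' ih => exact ih.trans (h _ h'.1 _ h'.2.1 h'.2.2)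
  intro v _ hc
  exact lt_irrefl _ (this v v hc)

theorem acyclic_singleton {V : Type} {Adj : V → V → Prop} (hi : ∀ x, ¬ Adj x x) (x : V) :
    AcyclicOn Adj {x} := by
  apply acyclic_of_rank (fun _ => 0)
  rintro a rfl b rfl h
  exact (hi _ h).elim

theorem color_union {V : Type} {Adj : V → V → Prop} {S T : Set V} {k l : ℕ}
    (hS : DiColorableOn Adj S k) (hT : DiColorableOn Adj T l) :
    DiColorableOn Adj (S ∪ T) (k + l) := by
  classical
  obtain ⟨c, hc, hc'⟩ := hS
  obtain ⟨d, hd, hd'⟩ := hT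
  refine ⟨fun v => if v ∈ S then c v else k + d v, ?_, ?_⟩
  · intro v hv
    by_cases h : v ∈ S
    · simp only [h, if_true]; have := hc v h; omega
    · simp only [h, if_false]; have := hd v (hv.resolve_left h); omega
  · intro i
    by_cases hi : i < k
    · refine acyclic_mono ?_ (hc' i)
      rintro v ⟨_, hv⟩
      by_cases h : v ∈ S
      · simp only [h, if_true] at hv; exact ⟨h, hv⟩
      · simp only [h, if_false] at hv; omega
    · refine acyclic_mono ?_ (hd' (i - k))
      rintro v ⟨hv', hv⟩
      by_cases h : v ∈ S
      · simp only [h, if_true] at hv; have := hc v h; omega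
      · simp only [h, if_false] at hv; exact ⟨hv'.resolve_left h, by omega⟩

theorem color_mono {V : Type} {Adj : V → V → Prop} {S T : Set V} {k : ℕ} (h : S ⊆ T)
    (hT : DiColorableOn Adj T k) : DiColorableOn Adj S k := by
  obtain ⟨c, hc, hc'⟩ := hT
  exact ⟨c, fun v hv => hc v (h hv), fun i =>
    acyclic_mono (T := {v ∈ T | c v = i}) (fun v hv => And.intro (h hv.1) hv.2) (hc' i)⟩

theorem color_one {V : Type} {Adj : V → V → Prop} {S : Set V} (h : AcyclicOn Adj S) :
    DiColorableOn Adj S 1 :=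
  ⟨fun _ => 0, fun _ _ => Nat.one_pos, fun _ => acyclic_mono (fun _ hv => hv.1) h⟩

theorem color_join {V : Type} {Adj : V → V → Prop} {S T : Set V} {k : ℕ}
    (hS : DiColorableOn Adj S k) (hT : DiColorableOn Adj T k) (hd : Disjoint S T)
    (hno : ∀ a ∈ S, ∀ b ∈ T, ¬ Adj a b) :
    DiColorableOn Adj (S ∪ T) k := by
  classical
  obtain ⟨c, hc, hc'⟩ := hS
  obtain ⟨d, hd, hd'⟩ := hT
  refine ⟨fun v => if v ∈ S then c v else d v, ?_, ?_⟩
  · intro v hv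
    by_cases h : v ∈ S
    · simp only [h, if_true]; exact hc v h
    · simp only [h, if_false]; exact hd v (hv.resolve_left h)
  · intro i
    refine acyclic_mono ?_ (acyclic_union (hc' i) (hd' i) (fun a ha b hb => hno a ha.1 b hb.1))
    rintro v ⟨hv', hv⟩
    by_cases h : v ∈ S
    · simp only [h, if_true] at hv; exact Or.inl ⟨h, hv⟩
    · simp only [h, if_false] at hv; exact Or.inr ⟨hv'.resolve_left h, hv⟩

theorem exists_strong {V : Type} [Finite V] {Adj : V → V → Prop} {S : Set V} {k : ℕ}
    (h : ¬ DiColorableOn Adj S k) :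
    ∃ T ⊆ S, ¬ DiColorableOn Adj T k ∧ StronglyConnectedOn Adj T := by
  obtain ⟨T, hTS, hT⟩ := (Set.toFinite {T : Set V | ¬ DiColorableOn Adj T k}).exists_le_minimal h
  refine ⟨T, hTS, hT.prop, ?_⟩
  intro u hu v hv
  by_contra hr
  set R : Set V := {x ∈ T | Relation.ReflTransGen (RelOn Adj T) u x} with hR
  have smaller : ∀ Q : Set V, Q ⊆ T → Q ≠ T → DiColorableOn Adj Q k := by
    intro Q hQ hne
    by_contra hc
    exact hne (Set.Subset.antisymm hQ (hT.le_of_le hc hQ))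
  have h1 : DiColorableOn Adj R k := smaller R (fun x hx => hx.1) (fun e => by
    have : v ∈ R := e ▸ hv
    exact hr this.2)
  have h2 : DiColorableOn Adj (T \ R) k := smaller _ Set.sdiff_subset (fun e => by
    have : u ∈ T \ R := by rw [e]; exact hu
    exact this.2 ⟨hu, .refl⟩)
  apply hT.prop
  refine color_mono ?_ (color_join h1 h2 Set.disjoint_sdiff_right ?_)
  · intro x hx
    by_cases hxR : x ∈ R
    · exact Or.inl hxR
    · exact Or.inr ⟨hx, hxR⟩
  · intro a ha b hb hab
    exact hb.2 ⟨hb.1, ha.2.tail ⟨ha.1, hb.1, hab⟩⟩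

def ReachN {V : Type} (r : V → V → Prop) (t : V) : ℕ → V → Prop
  | 0, u => u = t
  | n + 1, u => ∃ w, r u w ∧ ReachN r t n w

theorem exists_reachN {V : Type} {r : V → V → Prop} {t u : V}
    (h : Relation.ReflTransGen r u t) : ∃ n, ReachN r t n u := by
  induction h using Relation.ReflTransGen.head_induction_on with
  | refl => exact ⟨0, rfl⟩
  | head h _ ih => obtain ⟨n, hn⟩ := ih; exact ⟨n + 1, _, h, hn⟩

theorem exists_path {V : Type} {Adj : V → V → Prop} {S : Set V} (hi : ∀ x, ¬ Adj x x)
    (hS : StronglyConnectedOn Adj S) {s t : V} (hs : s ∈ S) (ht : t ∈ S) :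
    ∃ P ⊆ S, s ∈ P ∧ t ∈ P ∧ (∀ x ∈ P, Relation.ReflTransGen (RelOn Adj P) s x) ∧
      (∀ x ∈ P, Relation.ReflTransGen (RelOn Adj P) x t) ∧ DiColorableOn Adj P 2 := by
  classical
  set d : V → ℕ := fun u => sInf {n | ReachN (RelOn Adj S) t n u} with hd
  have dmem : ∀ u ∈ S, ReachN (RelOn Adj S) t (d u) u := fun u hu =>
    Nat.sInf_mem (s := {n | ReachN (RelOn Adj S) t n u}) (exists_reachN (hS hu ht))
  have dle : ∀ u n, ReachN (RelOn Adj S) t n u → d u ≤ n := fun u n h => Nat.sInf_le h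
  have dedge : ∀ a ∈ S, ∀ b ∈ S, Adj a b → d a ≤ d b + 1 := fun a ha b hb hab =>
    dle a _ ⟨b, ⟨ha, hb, hab⟩, dmem b hb⟩
  have key : ∀ n, ∀ u ∈ S, d u = n → ∃ P ⊆ S, u ∈ P ∧ t ∈ P ∧
      (∀ x ∈ P, Relation.ReflTransGen (RelOn Adj P) u x) ∧
      (∀ x ∈ P, Relation.ReflTransGen (RelOn Adj P) x t) ∧
      (∀ x ∈ P, d x ≤ n) ∧ (∀ x ∈ P, ∀ y ∈ P, d x = d y → x = y) := by
    intro n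
    induction n with
    | zero =>
      intro u hu hn
      have h := dmem u hu
      rw [hn] at h
      have h : u = t := h
      subst h
      refine ⟨{u}, by simpa using hu, rfl, rfl, ?_, ?_, ?_, ?_⟩
      · rintro x rfl; exact .refl
      · rintro x rfl; exact .refl
      · rintro x rfl; exact hn.le
      · rintro x rfl y rfl _; rfl
    | succ n ih =>
      intro u hu hn
      have h := dmem u hu
      rw [hn] at h
      obtain ⟨w, huw, hw⟩ := h
      have hwn : d w = n := by
        have h1 := dle w n hw
        have h2 := dedge u hu w huw.2.1 huw.2.2
        omega
      obtain ⟨P, hPS, hwP, htP, h1, h2, h3, h4⟩ := ih w huw.2.1 hwn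
      have hsub : P ⊆ insert u P := Set.subset_insert _ _
      have e : RelOn Adj (insert u P) u w := ⟨Set.mem_insert _ _, hsub hwP, huw.2.2⟩
      refine ⟨insert u P, Set.insert_subset hu hPS, Set.mem_insert _ _, hsub htP, ?_, ?_, ?_, ?_⟩
      · rintro x (rfl | hx)
        · exact .refl
        · exact .head e (Relation.ReflTransGen.mono (relOn_mono hsub) _ _ (h1 x hx))
      · rintro x (rfl | hx)
        · exact .head e (Relation.ReflTransGen.mono (relOn_mono hsub) _ _ (h2 w hwP))
        · exact Relation.ReflTransGen.mono (relOn_mono hsub) _ _ (h2 x hx)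
      · rintro x (rfl | hx)
        · exact hn.le
        · exact (h3 x hx).trans n.le_succ
      · rintro x (rfl | hx) y (rfl | hy) hxy
        · rfl
        · have := h3 y hy; omega
        · have := h3 x hx; omega
        · exact h4 x hx y hy hxy
  obtain ⟨P, hPS, hsP, htP, h1, h2, _, h4⟩ := key _ s hs rfl
  refine ⟨P, hPS, hsP, htP, h1, h2, fun v => d v % 2, fun v _ => Nat.mod_lt _ (by norm_num), ?_⟩
  intro i
  apply acyclic_of_rank d
  rintro a ⟨ha, hai⟩ b ⟨hb, hbi⟩ hab
  have h5 := dedge a (hPS ha) b (hPS hb) hab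
  have h6 : d a ≠ d b := fun e => by
    have := h4 a ha b hb e
    subst this
    exact hi _ hab
  simp only at hai hbi
  omega

theorem exists_source {V : Type} [Finite V] {Adj : V → V → Prop} (hT : IsTournament Adj)
    {A : Set V} (hA : AcyclicOn Adj A) (hne : A.Nonempty) :
    ∃ s ∈ A, ∀ x ∈ A, x ≠ s → Adj s x := by
  have hirr : Std.Irrefl (Relation.TransGen (RelOn Adj A)) := ⟨by
    intro v hv
    have : v ∈ A := by
      obtain ⟨w, h, _⟩ := Relation.TransGen.tail'_iff.1 hv
      rename_i h2
      exact h2.2.1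
    exact hA v this hv⟩
  have wf : WellFounded (Relation.TransGen (RelOn Adj A)) :=
    Finite.wellFounded_of_trans_of_irrefl _
  obtain ⟨s, hs, hmin⟩ := wf.has_min A hne
  refine ⟨s, hs, fun x hx hxs => (hT.2 s x hxs.symm).2 fun h => ?_⟩
  exact hmin x hx (.single ⟨hx, hs, h⟩)

theorem exists_sink {V : Type} [Finite V] {Adj : V → V → Prop} (hT : IsTournament Adj)
    {A : Set V} (hA : AcyclicOn Adj A) (hne : A.Nonempty) :
    ∃ s ∈ A, ∀ x ∈ A, x ≠ s → Adj x s := by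
  have hT' : IsTournament (fun a b => Adj b a) :=
    ⟨fun x => hT.1 x, fun u v h => hT.2 v u h.symm⟩
  refine exists_source (Adj := fun a b => Adj b a) hT' ?_ hne
  intro v hv hc
  apply hA v hv
  have := Relation.transGen_swap.2 hc
  refine Relation.TransGen.mono ?_ _ _ this
  rintro a b ⟨h1, h2, h3⟩
  exact ⟨h2, h1, h3⟩

theorem main {V : Type} [Finite V] {Adj : V → V → Prop} (hT : IsTournament Adj) (r : ℕ) :
    ∀ S : Set V, ¬ DiColorableOn Adj S (3 * r) →
    ∃ X : Fin (r + 1) → Set V,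
    (∀ i, X i ⊆ S) ∧
    (∀ i, (X i).Nonempty) ∧
    (∀ i j, i ≠ j → Disjoint (X i) (X j)) ∧
    (∀ i, StronglyConnectedOn Adj (X i)) ∧
    (∀ i j, i ≠ j → ∃ u ∈ X i, ∃ v ∈ X j, Adj u v) := by
  have hi : ∀ x, ¬ Adj x x := fun x => hT.1 x
  have nonempty : ∀ (S : Set V) k, ¬ DiColorableOn Adj S k → S.Nonempty := by
    intro S k h
    by_contra hS
    rw [Set.not_nonempty_iff_eq_empty] at hS
    subst hS
    exact h ⟨fun _ => 0, fun v hv => hv.elim, fun i v hv => hv.1.elim⟩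
  induction r with
  | zero =>
    intro S hS
    obtain ⟨x, hx⟩ := nonempty S _ hS
    refine ⟨fun _ => {x}, fun _ => by simpa using hx, fun _ => ⟨x, rfl⟩, ?_, ?_, ?_⟩
    · intro i j h; exact (h (Subsingleton.elim (α := Fin 1) i j)).elim
    · rintro _ u rfl v rfl; exact .refl
    · intro i j h; exact (h (Subsingleton.elim (α := Fin 1) i j)).elim
  | succ r ih =>
    intro S0 hS0
    obtain ⟨S, hSS, hS, hstr⟩ := exists_strong hS0
    obtain ⟨x0, hx0⟩ := nonempty S _ hS
    obtain ⟨A, hxA, hA⟩ := (Set.toFinite {A : Set V | A ⊆ S ∧ AcyclicOn Adj A}).exists_le_maximal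
      (a := {x0}) ⟨by simpa using hx0, acyclic_singleton hi x0⟩
    have hAne : A.Nonempty := ⟨x0, hxA rfl⟩
    obtain ⟨hAS, hAac⟩ := hA.prop
    obtain ⟨s, hs, hs'⟩ := exists_source hT hAac hAne
    obtain ⟨t, ht, ht'⟩ := exists_sink hT hAac hAne
    obtain ⟨P, hPS, htP, hsP, hP1, hP2, hPc⟩ := exists_path hi hstr (hAS ht) (hAS hs)
    have hBS : A ∪ P ⊆ S := Set.union_subset hAS hPS
    have hnot : ∀ x ∈ S \ (A ∪ P), ¬ AcyclicOn Adj ({x} ∪ A) := by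
      intro x hx hac
      have := hA.le_of_ge (y := {x} ∪ A)
        ⟨Set.union_subset (by simpa using hx.1) hAS, hac⟩ Set.subset_union_right
      exact hx.2 (Or.inl (this (Or.inl rfl)))
    have hout : ∀ x ∈ S \ (A ∪ P), ∃ a ∈ A, Adj x a := by
      intro x hx
      by_contra hno
      push Not at hno
      apply hnot x hx
      exact acyclic_union (acyclic_singleton hi x) hAac (by rintro a rfl b hb; exact hno b hb)
    have hin : ∀ x ∈ S \ (A ∪ P), ∃ a ∈ A, Adj a x := by
      intro x hx
      by_contra hno
      push Not at hno
      apply hnot x hx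
      rw [Set.union_comm]
      exact acyclic_union hAac (acyclic_singleton hi x) (by rintro a ha b rfl; exact hno a ha)
    have hBstr : StronglyConnectedOn Adj (A ∪ P) := by
      have fromA : ∀ x ∈ A, Relation.ReflTransGen (RelOn Adj (A ∪ P)) s x := by
        intro x hx
        by_cases h : x = s
        · subst h; exact .refl
        · exact .single ⟨Or.inl hs, Or.inl hx, hs' x hx h⟩
      have toA : ∀ x ∈ A, Relation.ReflTransGen (RelOn Adj (A ∪ P)) x t := by
        intro x hx
        by_cases h : x = t
        · subst h; exact .refl
        · exact .single ⟨Or.inl hx, Or.inl ht, ht' x hx h⟩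
      have up : ∀ a b, Relation.ReflTransGen (RelOn Adj P) a b →
          Relation.ReflTransGen (RelOn Adj (A ∪ P)) a b := fun a b h =>
        Relation.ReflTransGen.mono (relOn_mono Set.subset_union_right) _ _ h
      have h1 : ∀ x ∈ A ∪ P, Relation.ReflTransGen (RelOn Adj (A ∪ P)) s x := by
        rintro x (hx | hx)
        · exact fromA x hx
        · exact (fromA t ht).trans (up _ _ (hP1 x hx))
      have h2 : ∀ x ∈ A ∪ P, Relation.ReflTransGen (RelOn Adj (A ∪ P)) x s := by
        rintro x (hx | hx)
        · exact (toA x hx).trans (up _ _ (hP2 t htP))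
        · exact up _ _ (hP2 x hx)
      intro u hu v hv
      exact (h2 u hu).trans (h1 v hv)
    have hrest : ¬ DiColorableOn Adj (S \ (A ∪ P)) (3 * r) := by
      intro hc
      apply hS
      have := color_union hc (color_union (color_one hAac) hPc)
      refine color_mono ?_ this
      intro x hx
      by_cases h : x ∈ A ∪ P
      · exact Or.inr h
      · exact Or.inl ⟨hx, h⟩
    obtain ⟨X, hX1, hX2, hX3, hX4, hX5⟩ := ih _ hrest
    have hdis : ∀ i, Disjoint (A ∪ P) (X i) := fun i =>
      Set.disjoint_left.2 fun x hx hxi => (hX1 i hxi).2 hx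
    refine ⟨Fin.cons (A ∪ P) X, ?_, ?_, ?_, ?_, ?_⟩
    · intro i
      refine Fin.cases ?_ (fun i => ?_) i
      · exact hBS.trans hSS
      · exact ((hX1 i).trans Set.sdiff_subset).trans hSS
    · intro i
      refine Fin.cases ?_ (fun i => ?_) i
      · exact hAne.mono Set.subset_union_left
      · exact hX2 i
    · intro i j
      refine Fin.cases ?_ (fun i => ?_) i <;> refine Fin.cases ?_ (fun j => ?_) j
      · intro h; exact (h rfl).elim
      · intro _; exact hdis j
      · intro _; exact (hdis i).symm
      · intro h; exact hX3 i j (fun e => h (by rw [e]))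
    · intro i
      refine Fin.cases ?_ (fun i => ?_) i
      · exact hBstr
      · exact hX4 i
    · intro i j
      refine Fin.cases ?_ (fun i => ?_) i <;> refine Fin.cases ?_ (fun j => ?_) j
      · intro h; exact (h rfl).elim
      · intro _
        obtain ⟨x, hx⟩ := hX2 j
        obtain ⟨a, ha, hax⟩ := hin x (hX1 j hx)
        exact ⟨a, Or.inl ha, x, hx, hax⟩
      · intro _
        obtain ⟨x, hx⟩ := hX2 i
        obtain ⟨a, ha, hax⟩ := hout x (hX1 i hx)
        exact ⟨x, hx, a, Or.inl ha, hax⟩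
      · intro h; exact hX5 i j (fun e => h (by rw [e]))

end TMinor

/-- every tournament `T` with dichromatic number at least `3r`
(`r ≥ 1`) contains a strong `K⃗ r` minor. -/
theorem tournament_chi_ge_three_r_strong_minor
    {V : Type} [Fintype V] (Adj : V → V → Prop) (hT : IsTournament Adj)
    (r : ℕ) (hr : 1 ≤ r)
    (hchi : 3 * r ≤ dichromaticNumberOn Adj Set.univ) :
    ContainsStrongCompleteMinor Adj r := by
  obtain ⟨r, rfl⟩ : ∃ k, r = k + 1 := ⟨r - 1, by omega⟩
  have h : ¬ DiColorableOn Adj Set.univ (3 * r) := by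
    intro hc
    have : dichromaticNumberOn Adj Set.univ ≤ 3 * r := Nat.sInf_le hc
    omega
  obtain ⟨X, _, h⟩ := TMinor.main hT r _ h
  exact ⟨X, h⟩
end

section
/- Let T be a strongly connected tournament with at least two vertices. Then there exists a subset R ⊆ V(T) such that: the induced subtournament T[R] is strongly connected; R is dominating in T (every vertex of V(T) \ R has both an in-neighbour and an out-neighbour in R); and χ(T[R]) = 2. -/
/-- `S` carries a rank function strictly increasing along edges. -/
def RkOn {V : Type} (Adj : V → V → Prop) (S : Set V) : Prop :=
  ∃ f : V → ℕ, ∀ a ∈ S, ∀ b ∈ S, Adj a b → f a < f b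

lemma RkOn.mono {V : Type} {Adj : V → V → Prop} {S S' : Set V} (h : RkOn Adj S')
    (hs : S ⊆ S') : RkOn Adj S := by
  obtain ⟨f, hf⟩ := h
  exact ⟨f, fun a ha b hb => hf a (hs ha) b (hs hb)⟩

lemma acyclicOn_of_rel {V : Type} {Adj : V → V → Prop} {S : Set V} (r : V → V → Prop)
    (hirr : ∀ a, ¬ r a a) (htr : ∀ a b c, r a b → r b c → r a c)
    (h : ∀ a ∈ S, ∀ b ∈ S, Adj a b → r a b) : AcyclicOn Adj S := by
  intro v _ hc
  have key : ∀ w, Relation.TransGen (fun a b => a ∈ S ∧ b ∈ S ∧ Adj a b) v w → r v w := by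
    intro w hw
    induction hw with
    | single h1 => exact h _ h1.1 _ h1.2.1 h1.2.2
    | tail _ h1 ih => exact htr _ _ _ ih (h _ h1.1 _ h1.2.1 h1.2.2)
  exact hirr v (key v hc)

lemma RkOn.acyclic {V : Type} {Adj : V → V → Prop} {S : Set V} (h : RkOn Adj S) :
    AcyclicOn Adj S := by
  obtain ⟨f, hf⟩ := h
  exact acyclicOn_of_rel (fun a b => f a < f b) (fun a => lt_irrefl _)
    (fun a b c h1 h2 => lt_trans h1 h2) hf

section tour
variable {V : Type} {Adj : V → V → Prop}

lemma IsTournament.asymm (hT : IsTournament Adj) {a b : V} (h : Adj a b) : ¬ Adj b a := by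
  by_cases hab : a = b
  · subst hab
    exact absurd h (hT.1 a)
  · exact (hT.2 a b hab).1 h

lemma IsTournament.adj_of (hT : IsTournament Adj) {a b : V} (hab : a ≠ b) (h : ¬ Adj a b) :
    Adj b a := (hT.2 b a (Ne.symm hab)).2 h

lemma IsTournament.ne (hT : IsTournament Adj) {a b : V} (h : Adj a b) : a ≠ b := by
  rintro rfl
  exact hT.1 _ h

lemma rkOn_pair (hT : IsTournament Adj) (x y : V) : RkOn Adj {x, y} := by
  classical
  by_cases h : Adj x y
  · refine ⟨fun z => if z = x then 0 else 1, ?_⟩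
    have h1 := hT.asymm h
    have h2 := hT.1 x
    have h3 := hT.1 y
    have h4 := hT.ne h
    rintro a (rfl | rfl) b (rfl | rfl) hab <;> simp_all
    rw [if_neg (Ne.symm h4)]
    exact Nat.one_pos
  · refine ⟨fun z => if z = y then 0 else 1, ?_⟩
    have h2 := hT.1 x
    have h3 := hT.1 y
    rintro a (rfl | rfl) b (rfl | rfl) hab <;> simp_all
    rw [if_neg (Ne.symm (hT.ne hab))]
    exact Nat.one_pos

lemma RkOn.source (hT : IsTournament Adj) {S : Set V} (h : RkOn Adj S) (hne : S.Nonempty) :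
    ∃ c ∈ S, ∀ x ∈ S, x = c ∨ Adj c x := by
  obtain ⟨f, hf⟩ := h
  obtain ⟨c, hc, hmin⟩ := (measure f).wf.has_min S hne
  refine ⟨c, hc, fun x hx => ?_⟩
  by_contra hcon
  push Not at hcon
  exact hmin x hx (hf x hx c hc (hT.adj_of (Ne.symm hcon.1) hcon.2))

lemma RkOn.sink [Fintype V] (hT : IsTournament Adj) {S : Set V} (h : RkOn Adj S)
    (hne : S.Nonempty) :
    ∃ c ∈ S, ∀ x ∈ S, x = c ∨ Adj x c := by
  obtain ⟨f, hf⟩ := h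
  obtain ⟨c, hc, hmax⟩ := S.exists_max_image f S.toFinite hne
  refine ⟨c, hc, fun x hx => ?_⟩
  by_contra hcon
  push Not at hcon
  exact absurd (hf c hc x hx (hT.adj_of hcon.1 hcon.2)) (not_lt.2 (hmax x hx))

lemma exists_max_rk [Fintype V] (hT : IsTournament Adj) (L S : Set V) (hSL : S ⊆ L)
    (hS : RkOn Adj S) :
    ∃ A, S ⊆ A ∧ A ⊆ L ∧ RkOn Adj A ∧
      ∀ v ∈ L, v ∉ A → (∃ a ∈ A, Adj a v) ∧ (∃ a ∈ A, Adj v a) := by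
  classical
  obtain ⟨A, hA⟩ := (Set.toFinite {A : Set V | S ⊆ A ∧ A ⊆ L ∧ RkOn Adj A}).exists_maximal
    ⟨S, subset_rfl, hSL, hS⟩
  obtain ⟨⟨hSA, hAL, f, hf⟩, hmax⟩ := hA
  refine ⟨A, hSA, hAL, ⟨f, hf⟩, fun v hv hvA => ?_⟩
  have key : ¬ RkOn Adj (insert v A) := by
    intro hr
    have := @hmax (insert v A) ⟨hSA.trans (Set.subset_insert _ _),
      Set.insert_subset hv hAL, hr⟩ (Set.subset_insert _ _)
    exact hvA (this (Set.mem_insert _ _))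
  constructor
  · by_contra hcon
    push Not at hcon
    apply key
    refine ⟨fun x => if x = v then 0 else f x + 1, ?_⟩
    rintro a (rfl | ha) b (rfl | hb) hab
    · exact absurd hab (hT.1 _)
    · have : b ≠ a := by rintro rfl; exact hvA hb
      simp [this]
    · exact absurd hab (hcon a ha)
    · have h1 : a ≠ v := by rintro rfl; exact hvA ha
      have h2 : b ≠ v := by rintro rfl; exact hvA hb
      simp [h1, h2, hf a ha b hb hab]
  · by_contra hcon
    push Not at hcon
    apply key
    refine ⟨fun x => if x = v then Finset.univ.sup f + 1 else f x, ?_⟩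
    rintro a (rfl | ha) b (rfl | hb) hab
    · exact absurd hab (hT.1 _)
    · exact absurd hab (hcon b hb)
    · have : a ≠ b := by rintro rfl; exact hvA ha
      simp only [this, if_true, if_false]
      exact Nat.lt_succ_of_le (Finset.le_sup (f := f) (Finset.mem_univ a))
    · have h1 : a ≠ v := by rintro rfl; exact hvA ha
      have h2 : b ≠ v := by rintro rfl; exact hvA hb
      simp [h1, h2, hf a ha b hb hab]

lemma dichromatic_eq_two {R : Set V} (hR : StronglyConnectedOn Adj R)
    {x y : V} (hx : x ∈ R) (hy : y ∈ R) (hxy : x ≠ y) (h2 : DiColorableOn Adj R 2) :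
    dichromaticNumberOn Adj R = 2 := by
  apply le_antisymm (Nat.sInf_le h2)
  apply le_csInf ⟨2, h2⟩
  rintro k ⟨c, hc, hac⟩
  by_contra hk
  have h0 : ∀ v ∈ R, c v = 0 := fun v hv => by have := hc v hv; omega
  have hS : {v ∈ R | c v = 0} = R := by
    ext v; exact ⟨fun h => h.1, fun h => ⟨h, h0 v h⟩⟩
  have h1 := hac 0
  rw [hS] at h1
  apply h1 x hx
  have e1 := hR hx hy
  have e2 := hR hy hx
  rcases Relation.reflTransGen_iff_eq_or_transGen.1 e1 with h | h
  · exact absurd h.symm hxy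
  · exact h.trans_left e2

/-- Reachability by walks of length at most `n`. -/
def Rch (Adj : V → V → Prop) (u : V) : ℕ → V → Prop
  | 0, x => x = u
  | n + 1, x => Rch Adj u n x ∨ ∃ y, Rch Adj u n y ∧ Adj y x

lemma exists_dist (hsc : StronglyConnectedOn Adj Set.univ) :
    ∃ d : V → V → ℕ, (∀ u x, d u x = 0 ↔ x = u) ∧
      (∀ u x y, Adj x y → d u y ≤ d u x + 1) ∧
      (∀ u x n, d u x = n + 1 → ∃ y, Adj y x ∧ d u y = n) := by
  classical
  have hex : ∀ u x, ∃ n, Rch Adj u n x := by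
    intro u x
    have := hsc (Set.mem_univ u) (Set.mem_univ x)
    induction this with
    | refl => exact ⟨0, rfl⟩
    | tail _ h ih =>
      obtain ⟨n, hn⟩ := ih
      exact ⟨n + 1, Or.inr ⟨_, hn, h.2.2⟩⟩
  have hstep : ∀ u x y, Adj x y → Nat.find (hex u y) ≤ Nat.find (hex u x) + 1 := fun u x y h =>
    Nat.find_min' _ (Or.inr ⟨x, Nat.find_spec (hex u x), h⟩)
  refine ⟨fun u x => Nat.find (hex u x), ?_, hstep, ?_⟩
  · intro u x
    rw [Nat.find_eq_zero]
    rfl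
  · intro u x n h
    have h1 := Nat.find_spec (hex u x)
    replace h : Nat.find (hex u x) = n + 1 := h
    rw [h] at h1
    rcases h1 with h1 | ⟨y, hy, hyx⟩
    · have := Nat.find_min' (hex u x) h1
      omega
    · refine ⟨y, hyx, ?_⟩
      have := Nat.find_min' (hex u y) hy
      have := hstep u y x hyx
      show Nat.find (hex u y) = n
      omega

lemma exists_path {d : V → ℕ} {u : V} (h0 : ∀ x, d x = 0 ↔ x = u)
    (hp : ∀ x n, d x = n + 1 → ∃ y, Adj y x ∧ d y = n) :
    ∀ n e, d e = n → ∃ p : ℕ → V, p 0 = u ∧ p n = e ∧ (∀ i ≤ n, d (p i) = i) ∧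
      ∀ i < n, Adj (p i) (p (i + 1)) := by
  intro n
  induction n with
  | zero =>
    intro e he
    have := (h0 e).1 he
    refine ⟨fun _ => u, rfl, this.symm, ?_, ?_⟩
    · intro i hi
      have : i = 0 := by omega
      subst this
      exact (h0 u).2 rfl
    · intro i hi
      omega
  | succ n ih =>
    intro e he
    obtain ⟨y, hy, hyn⟩ := hp e n he
    obtain ⟨p, p0, pn, pd, pa⟩ := ih y hyn
    refine ⟨fun i => if i = n + 1 then e else p i, ?_, ?_, ?_, ?_⟩
    · simp [p0]
    · simp
    · intro i hi
      by_cases h : i = n + 1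
      · simp [h, he]
      · simp only [h, if_false]
        exact pd i (by omega)
    · intro i hi
      have h1 : i ≠ n + 1 := by omega
      by_cases h : i = n
      · subst h
        simp [pn, hy]
      · have h2 : i + 1 ≠ n + 1 := by omega
        simp only [h1, h2, if_false]
        exact pa i (by omega)

lemma stronglyConnectedOn_of_hub {R : Set V} (u : V)
    (h1 : ∀ x ∈ R, Relation.ReflTransGen (fun a b => a ∈ R ∧ b ∈ R ∧ Adj a b) u x)
    (h2 : ∀ x ∈ R, Relation.ReflTransGen (fun a b => a ∈ R ∧ b ∈ R ∧ Adj a b) x u) :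
    StronglyConnectedOn Adj R := fun _ hx _ hy => (h2 _ hx).trans (h1 _ hy)

lemma case_small [Fintype V] (hT : IsTournament Adj) {d : V → V → ℕ} {x0 y0 : V} (hne : x0 ≠ y0)
    (h0 : ∀ u x, d u x = 0 ↔ x = u)
    (hp : ∀ u x n, d u x = n + 1 → ∃ y, Adj y x ∧ d u y = n)
    (h3 : ∀ u x, d u x ≤ 3) :
    ∃ R : Set V,
      StronglyConnectedOn Adj R ∧
      (∀ v ∉ R, (∃ u ∈ R, Adj u v) ∧ (∃ u ∈ R, Adj v u)) ∧
      dichromaticNumberOn Adj R = 2 := by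
  classical
  obtain ⟨A, hSA, -, hA, hdom⟩ := exists_max_rk hT Set.univ {x0, y0} (Set.subset_univ _)
    (rkOn_pair hT x0 y0)
  have hx0 : x0 ∈ A := hSA (by simp)
  have hy0 : y0 ∈ A := hSA (by simp)
  obtain ⟨a, ha, hsrc⟩ := hA.source hT ⟨x0, hx0⟩
  obtain ⟨b, hb, hsnk⟩ := hA.sink hT ⟨x0, hx0⟩
  have hab : a ≠ b := by
    rintro rfl
    rcases hsrc x0 hx0 with h | h
    · rcases hsrc y0 hy0 with h' | h'
      · exact hne (h.trans h'.symm)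
      · rcases hsnk y0 hy0 with h2 | h2
        · exact hne (h.trans h2.symm)
        · exact hT.asymm h' h2
    · rcases hsnk x0 hx0 with h2 | h2
      · exact hT.ne h h2.symm
      · exact hT.asymm h h2
  have hAab : Adj a b := by
    rcases hsrc b hb with h | h
    · exact absurd h.symm hab
    · exact h
  obtain ⟨w1, w2, hb1, h12, h2a⟩ : ∃ w1 w2, Adj b w1 ∧ (w1 = w2 ∨ Adj w1 w2) ∧ Adj w2 a := by
    obtain ⟨p, p0, pn, -, pa⟩ := exists_path (h0 b) (hp b) (d b a) a rfl
    have hle := h3 b a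
    generalize d b a = n at *
    interval_cases n
    · exact absurd (pn.symm.trans p0) hab
    · have := pa 0 (by omega)
      rw [p0] at this
      simp only [zero_add] at this
      rw [pn] at this
      exact absurd this (hT.asymm hAab)
    · have e1 := pa 0 (by omega)
      have e2 := pa 1 (by omega)
      simp only [zero_add, Nat.reduceAdd, p0, pn] at e1 e2
      exact ⟨p 1, p 1, e1, Or.inl rfl, e2⟩
    · have e1 := pa 0 (by omega)
      have e2 := pa 1 (by omega)
      have e3 := pa 2 (by omega)
      simp only [zero_add, Nat.reduceAdd, p0, pn] at e1 e2 e3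
      exact ⟨p 1, p 2, e1, Or.inr e2, e3⟩
  let R : Set V := A ∪ {w1, w2}
  have hAR : ∀ x ∈ A, x ∈ R := fun x hx => Or.inl hx
  have hw1 : w1 ∈ R := by simp [R]
  have hw2 : w2 ∈ R := by simp [R]
  let r : V → V → Prop := fun a b => a ∈ R ∧ b ∈ R ∧ Adj a b
  have ax : ∀ x ∈ A, Relation.ReflTransGen r a x := by
    intro x hx
    rcases hsrc x hx with rfl | h
    · exact .refl
    · exact .single ⟨hAR _ ha, hAR _ hx, h⟩
  have xb : ∀ x ∈ A, Relation.ReflTransGen r x b := by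
    intro x hx
    rcases hsnk x hx with rfl | h
    · exact .refl
    · exact .single ⟨hAR _ hx, hAR _ hb, h⟩
  have bw1 : Relation.ReflTransGen r b w1 := .single ⟨hAR _ hb, hw1, hb1⟩
  have w12 : Relation.ReflTransGen r w1 w2 := by
    rcases h12 with rfl | h
    · exact .refl
    · exact .single ⟨hw1, hw2, h⟩
  have w2a : Relation.ReflTransGen r w2 a := .single ⟨hw2, hAR _ ha, h2a⟩
  have hstr : StronglyConnectedOn Adj R := by
    apply stronglyConnectedOn_of_hub a
    · rintro x (hx | rfl | rfl)
      · exact ax x hx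
      · exact (ax b hb).trans bw1
      · exact ((ax b hb).trans bw1).trans w12
    · rintro x (hx | rfl | rfl)
      · exact (((xb x hx).trans bw1).trans w12).trans w2a
      · exact w12.trans w2a
      · exact w2a
  refine ⟨R, hstr, ?_, dichromatic_eq_two hstr (hAR _ hx0) (hAR _ hy0) hne ?_⟩
  · intro v hv
    obtain ⟨⟨s, hs, hs'⟩, ⟨t, ht, ht'⟩⟩ := hdom v (Set.mem_univ v) (fun h => hv (hAR _ h))
    exact ⟨⟨s, hAR _ hs, hs'⟩, ⟨t, hAR _ ht, ht'⟩⟩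
  · refine ⟨fun x => if x ∈ A then 0 else 1, ?_, ?_⟩
    · intro v _
      dsimp only
      split_ifs <;> omega
    · intro i
      apply RkOn.acyclic
      by_cases hi : i = 0
      · apply hA.mono
        rintro x ⟨_, hx⟩
        by_contra hxA
        simp [hxA] at hx
        omega
      · apply (rkOn_pair hT w1 w2).mono
        rintro x ⟨hx | hx, hx'⟩
        · simp [hx] at hx'
          omega
        · exact hx

lemma case_large [Fintype V] (hT : IsTournament Adj) {d : V → ℕ} {u x4 : V}
    (h0 : ∀ x, d x = 0 ↔ x = u)
    (hs : ∀ x y, Adj x y → d y ≤ d x + 1)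
    (hp : ∀ x n, d x = n + 1 → ∃ y, Adj y x ∧ d y = n)
    (hx4 : 4 ≤ d x4)
    (hq : ∀ z, d z = 1 → ∃ q, Adj z q ∧ d q = 2) :
    ∃ R : Set V,
      StronglyConnectedOn Adj R ∧
      (∀ v ∉ R, (∃ u ∈ R, Adj u v) ∧ (∃ u ∈ R, Adj v u)) ∧
      dichromaticNumberOn Adj R = 2 := by
  classical
  have hback : ∀ x y, d x + 2 ≤ d y → Adj y x := by
    intro x y h
    apply hT.adj_of
    · rintro rfl; omega
    · intro h'
      have := hs _ _ h'
      omega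
  have hu1 : ∀ x, d x = 1 → Adj u x := by
    intro x hx
    obtain ⟨y, hy, hy0⟩ := hp x 0 hx
    rwa [(h0 y).1 hy0] at hy
  have hdu : d u = 0 := (h0 u).2 rfl
  have hrk1 : ∀ x, RkOn Adj {x} := fun x => (rkOn_pair hT x x).mono (by simp)
  obtain ⟨xm, -, hmax⟩ := Set.exists_max_image Set.univ d Set.finite_univ ⟨u, trivial⟩
  obtain ⟨m, hm⟩ : ∃ m, d xm = m + 1 := ⟨d xm - 1, by have := hmax x4 trivial; omega⟩
  have hmax' : ∀ x, d x ≤ m + 1 := fun x => hm ▸ hmax x trivial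
  have hm3 : 3 ≤ m := by have := hmax' x4; omega
  obtain ⟨C, hC0, hCL, hCr, hCd⟩ := exists_max_rk hT {x | d x = m + 1} {xm} (by simpa using hm)
    (hrk1 _)
  obtain ⟨c, hc, hcs⟩ := hCr.source hT ⟨xm, hC0 rfl⟩
  obtain ⟨b', hb'c, hb'm⟩ := hp c m (hCL hc)
  -- the layer before it
  obtain ⟨B, hB0, hBL, hBr, hBd⟩ := exists_max_rk hT {x | d x = m} {b'} (by simpa using hb'm)
    (hrk1 _)
  have hb' : b' ∈ B := hB0 rfl
  obtain ⟨e, he, hes⟩ := hBr.source hT ⟨b', hb'⟩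
  obtain ⟨p, p0, pm, pd, pa⟩ := exists_path h0 hp m e (hBL he)
  -- the first layer
  obtain ⟨A, hA0, hAL, hAr, hAd⟩ := exists_max_rk hT {x | d x = 1} {p 1}
    (by simpa using pd 1 (by omega)) (hrk1 _)
  have hp1 : p 1 ∈ A := hA0 rfl
  obtain ⟨s, hsA, hss⟩ := hAr.sink hT ⟨p 1, hp1⟩
  obtain ⟨q, hsq, hq2⟩ := hq s (hAL hsA)
  let R : Set V := {x | x ∈ A ∨ x ∈ B ∨ x ∈ C ∨ x = q ∨ ∃ i ≤ m, x = p i}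
  have hAR : ∀ x ∈ A, x ∈ R := fun x hx => Or.inl hx
  have hBR : ∀ x ∈ B, x ∈ R := fun x hx => Or.inr (Or.inl hx)
  have hCR : ∀ x ∈ C, x ∈ R := fun x hx => Or.inr (Or.inr (Or.inl hx))
  have hqR : q ∈ R := Or.inr (Or.inr (Or.inr (Or.inl rfl)))
  have hpR : ∀ i ≤ m, p i ∈ R := fun i hi => Or.inr (Or.inr (Or.inr (Or.inr ⟨i, hi, rfl⟩)))
  have huR : u ∈ R := p0 ▸ hpR 0 (by omega)
  have hlay : ∀ x ∈ R, (d x = 1 ∧ x ∈ A) ∨ (d x = m ∧ x ∈ B) ∨ (d x = m + 1 ∧ x ∈ C) ∨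
      (d x ≠ 1 ∧ d x ≠ m ∧ d x ≠ m + 1 ∧ (x = q ∨ x = p (d x))) := by
    have hmid : ∀ x, d x ≤ m → x = p (d x) → (d x = 1 ∧ x ∈ A) ∨ (d x = m ∧ x ∈ B) ∨
        (d x = m + 1 ∧ x ∈ C) ∨
        (d x ≠ 1 ∧ d x ≠ m ∧ d x ≠ m + 1 ∧ (x = q ∨ x = p (d x))) := by
      intro x hxm hx
      by_cases h1 : d x = 1
      · left
        refine ⟨h1, ?_⟩
        rw [hx, h1]
        exact hp1
      by_cases h2 : d x = m
      · right; left
        refine ⟨h2, ?_⟩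
        rw [hx, h2, pm]
        exact he
      exact Or.inr (Or.inr (Or.inr ⟨h1, h2, by omega, Or.inr hx⟩))
    rintro x (hx | hx | hx | rfl | ⟨i, hi, rfl⟩)
    · exact Or.inl ⟨hAL hx, hx⟩
    · exact Or.inr (Or.inl ⟨hBL hx, hx⟩)
    · exact Or.inr (Or.inr (Or.inl ⟨hCL hx, hx⟩))
    · exact Or.inr (Or.inr (Or.inr ⟨by omega, by omega, by omega, Or.inl rfl⟩))
    · apply hmid
      · rw [pd i hi]; exact hi
      · rw [pd i hi]
  let r : V → V → Prop := fun a b => a ∈ R ∧ b ∈ R ∧ Adj a b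
  have up : ∀ i ≤ m, Relation.ReflTransGen r u (p i) := by
    intro i
    induction i with
    | zero => intro _; rw [p0]
    | succ i ih =>
      intro hi
      exact (ih (by omega)).tail ⟨hpR i (by omega), hpR _ hi, pa i (by omega)⟩
  have uA : ∀ x ∈ A, Relation.ReflTransGen r u x := fun x hx =>
    .single ⟨huR, hAR x hx, hu1 x (hAL hx)⟩
  have uB : ∀ x ∈ B, Relation.ReflTransGen r u x := by
    intro x hx
    have h1 := up m le_rfl
    rw [pm] at h1
    rcases hes x hx with rfl | h
    · exact h1
    · exact h1.tail ⟨hBR _ he, hBR _ hx, h⟩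
  have uc : Relation.ReflTransGen r u c := (uB b' hb').tail ⟨hBR _ hb', hCR _ hc, hb'c⟩
  have uC : ∀ x ∈ C, Relation.ReflTransGen r u x := by
    intro x hx
    rcases hcs x hx with rfl | h
    · exact uc
    · exact uc.tail ⟨hCR _ hc, hCR _ hx, h⟩
  have uq : Relation.ReflTransGen r u q := (uA s hsA).tail ⟨hAR _ hsA, hqR, hsq⟩
  have back2 : ∀ x ∈ R, 2 ≤ d x → Relation.ReflTransGen r x u := fun x hx h =>
    .single ⟨hx, huR, hback u x (by omega)⟩
  have su : Relation.ReflTransGen r s u :=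
    .head ⟨hAR _ hsA, hqR, hsq⟩ (back2 q hqR (by omega))
  have hstr : StronglyConnectedOn Adj R := by
    apply stronglyConnectedOn_of_hub u
    · rintro x (hx | hx | hx | rfl | ⟨i, hi, rfl⟩)
      · exact uA x hx
      · exact uB x hx
      · exact uC x hx
      · exact uq
      · exact up i hi
    · intro x hx
      by_cases h2 : 2 ≤ d x
      · exact back2 x hx h2
      by_cases h1 : d x = 0
      · rw [(h0 x).1 h1]
      have hxA : x ∈ A := by
        rcases hlay x hx with h | h | h | h
        · exact h.2
        · omega
        · omega
        · omega
      rcases hss x hxA with rfl | h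
      · exact su
      · exact .head ⟨hx, hAR _ hsA, h⟩ su
  refine ⟨R, hstr, ?_, dichromatic_eq_two hstr huR hqR ?_ ?_⟩
  · intro v hv
    by_cases h2 : 2 ≤ d v
    · refine ⟨?_, u, huR, hback u v (by omega)⟩
      have := hmax' v
      by_cases hvm : d v = m
      · obtain ⟨⟨a, ha, h⟩, -⟩ := hBd v hvm (fun h => hv (hBR _ h))
        exact ⟨a, hBR _ ha, h⟩
      by_cases hvm1 : d v = m + 1
      · obtain ⟨⟨a, ha, h⟩, -⟩ := hCd v hvm1 (fun h => hv (hCR _ h))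
        exact ⟨a, hCR _ ha, h⟩
      have hcm : d c = m + 1 := hCL hc
      exact ⟨c, hCR _ hc, hback v c (by omega)⟩
    by_cases h1 : d v = 0
    · rw [(h0 v).1 h1] at hv
      exact absurd huR hv
    have h1 : d v = 1 := by omega
    obtain ⟨-, ⟨a, ha, h⟩⟩ := hAd v h1 (fun h => hv (hAR _ h))
    exact ⟨⟨u, huR, hu1 v h1⟩, a, hAR _ ha, h⟩
  · rintro rfl
    omega
  · have hrk : ∀ i, RkOn Adj {x | x ∈ R ∧ d x = i} := by
      intro i
      by_cases h1 : i = 1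
      · apply hAr.mono
        rintro x ⟨hx, hxi⟩
        rcases hlay x hx with h | h | h | h
        · exact h.2
        all_goals omega
      by_cases h2 : i = m
      · apply hBr.mono
        rintro x ⟨hx, hxi⟩
        rcases hlay x hx with h | h | h | h
        · omega
        · exact h.2
        all_goals omega
      by_cases h3 : i = m + 1
      · apply hCr.mono
        rintro x ⟨hx, hxi⟩
        rcases hlay x hx with h | h | h | h
        · omega
        · omega
        · exact h.2
        · omega
      apply (rkOn_pair hT q (p i)).mono
      rintro x ⟨hx, hxi⟩
      rcases hlay x hx with h | h | h | h
      · omega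
      · omega
      · omega
      · rw [hxi] at h
        exact h.2.2.2
    choose f hf using hrk
    refine ⟨fun x => d x % 2, fun v _ => Nat.mod_lt _ (by omega), fun i => ?_⟩
    apply acyclicOn_of_rel (fun a b => d b < d a ∨ (d a = d b ∧ f (d a) a < f (d b) b))
    · intro a h
      omega
    · intro a b c h1 h2
      omega
    · rintro a ⟨ha, hai⟩ b ⟨hb, hbi⟩ hab
      have h1 := hs a b hab
      by_cases h : d b < d a
      · exact Or.inl h
      · have e : d a = d b := by
          dsimp only at hai hbi
          omega
        refine Or.inr ⟨e, ?_⟩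
        rw [← e]
        exact hf (d a) a ⟨ha, rfl⟩ b ⟨hb, e.symm⟩ hab

end tour

/-- every strongly connected tournament on at least two
vertices has a subset `R` of vertices inducing a strongly connected
subtournament, dominating (every vertex outside `R` has both an in-neighbour
and an out-neighbour in `R`), and with `χ(T[R]) = 2`. -/
theorem strongly_connected_tournament_has_dominating_set
    {V : Type} [Fintype V] (Adj : V → V → Prop) (hT : IsTournament Adj)
    (hcard : 2 ≤ Fintype.card V)
    (hsc : StronglyConnectedOn Adj Set.univ) :
    ∃ R : Set V,
      StronglyConnectedOn Adj R ∧
      (∀ v ∉ R, (∃ u ∈ R, Adj u v) ∧ (∃ u ∈ R, Adj v u)) ∧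
      dichromaticNumberOn Adj R = 2 := by
  classical
  obtain ⟨d, h0, hs, hp⟩ := exists_dist hsc
  by_cases h3 : ∀ u x, d u x ≤ 3
  · obtain ⟨x0, y0, hne⟩ := Fintype.exists_pair_of_one_lt_card (α := V) (by omega)
    exact case_small hT hne h0 hp h3
  push Not at h3
  obtain ⟨u', x', hux'⟩ := h3
  obtain ⟨u, ⟨x, hux⟩, hmin⟩ := Set.exists_min_image {u | ∃ x, 4 ≤ d u x} (outDeg Adj)
    (Set.toFinite _) ⟨u', x', hux'⟩
  refine case_large hT (h0 u) (hs u) (hp u) hux ?_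
  intro z hz
  by_contra hcon
  push Not at hcon
  have hu1 : ∀ y, d u y = 1 → Adj u y := by
    intro y hy
    obtain ⟨w, hw, hw0⟩ := hp u y 0 hy
    rwa [(h0 u w).1 hw0] at hw
  have hz1 : ∀ y, Adj z y → d u y = 1 := by
    intro y hy
    have e1 := hs u z y hy
    have e2 := hcon y hy
    have e3 : d u y ≠ 0 := by
      intro h
      rw [(h0 u y).1 h] at hy
      exact hT.asymm hy (hu1 z hz)
    omega
  have hle : ∀ n y, d z y = n → d u y ≤ max 1 n := by
    intro n
    induction n with
    | zero =>
      intro y hy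
      rw [(h0 z y).1 hy, hz]
      simp
    | succ n ih =>
      intro y hy
      obtain ⟨w, hw, hwn⟩ := hp z y n hy
      by_cases hn : n = 0
      · rw [hn] at hwn
        rw [(h0 z w).1 hwn] at hw
        rw [hz1 y hw]
        simp
      · have := ih w hwn
        have := hs u w y hw
        omega
  have hmem : z ∈ {u | ∃ x, 4 ≤ d u x} := ⟨x, by
    have := hle _ x rfl
    omega⟩
  have hlt : outDeg Adj z < outDeg Adj u := by
    apply Set.ncard_lt_ncard _ (Set.toFinite _)
    refine ⟨fun y hy => hu1 y (hz1 y hy), fun hsub => ?_⟩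
    exact hT.1 z (hsub (hu1 z hz))
  exact absurd (hmin z hmem) (not_le.2 hlt)
end

section
/- If T is a tournament with dichromatic number χ(T) ≥ 3, then T contains a strong K⃗_2 minor, i.e. sm(T) ≥ 2. -/
/-- A directed triangle. -/
def DTri {V : Type} (Adj : V → V → Prop) (a b c : V) : Prop :=
  Adj a b ∧ Adj b c ∧ Adj c a

theorem DTri.strong {V : Type} {Adj : V → V → Prop} {a b c : V} (h : DTri Adj a b c) :
    StronglyConnectedOn Adj {a, b, c} := by
  obtain ⟨h1, h2, h3⟩ := h
  let R : V → V → Prop := fun x y => x ∈ ({a, b, c} : Set V) ∧ y ∈ ({a, b, c} : Set V) ∧ Adj x y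
  have r1 : Relation.ReflTransGen R a b := .single ⟨by simp, by simp, h1⟩
  have r2 : Relation.ReflTransGen R b c := .single ⟨by simp, by simp, h2⟩
  have r3 : Relation.ReflTransGen R c a := .single ⟨by simp, by simp, h3⟩
  intro u hu v hv
  change Relation.ReflTransGen R u v
  simp only [Set.mem_insert_iff, Set.mem_singleton_iff] at hu hv
  rcases hu with rfl | rfl | rfl <;> rcases hv with rfl | rfl | rfl
  · exact .refl
  · exact r1
  · exact r1.trans r2
  · exact r2.trans r3
  · exact .refl
  · exact r2
  · exact r3
  · exact r3.trans r1
  · exact .refl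

theorem minor_of_mixed {V : Type} {Adj : V → V → Prop} {a b c v u w : V}
    (h : DTri Adj a b c) (hv : v ∉ ({a, b, c} : Set V)) (hu : u ∈ ({a, b, c} : Set V))
    (hw : w ∈ ({a, b, c} : Set V)) (huv : Adj u v) (hvw : Adj v w) :
    ContainsStrongCompleteMinor Adj 2 := by
  have hs : StronglyConnectedOn Adj ({v} : Set V) := by
    rintro x rfl y rfl
    exact .refl
  refine ⟨![{v}, {a, b, c}], ?_, ?_, ?_, ?_⟩
  · intro i; fin_cases i <;> simp
  · intro i j hij
    fin_cases i <;> fin_cases j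
    · exact absurd rfl hij
    · exact Set.disjoint_singleton_left.2 hv
    · exact Set.disjoint_singleton_right.2 hv
    · exact absurd rfl hij
  · intro i; fin_cases i
    · exact hs
    · exact h.strong
  · intro i j hij
    fin_cases i <;> fin_cases j
    · exact absurd rfl hij
    · exact ⟨v, rfl, w, hw, hvw⟩
    · exact ⟨u, hu, v, rfl, huv⟩
    · exact absurd rfl hij

theorem dtri_unique {V : Type} {Adj : V → V → Prop} (hT : IsTournament Adj)
    (hn : ¬ ContainsStrongCompleteMinor Adj 2) {a b c x y : V}
    (h : DTri Adj a b c) (h' : DTri Adj a x y) : x = b ∧ y = c := by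
  have irr : ∀ v, ¬ Adj v v := fun v hv => by
    have := hT.1
    first
      | exact this v hv
      | exact this.irrefl v hv
  have asym : ∀ u v, Adj u v → ¬ Adj v u := fun u v huv => by
    have hne : u ≠ v := by rintro rfl; exact irr _ huv
    exact (hT.2 u v hne).1 huv
  have tot : ∀ u v, u ≠ v → ¬ Adj u v → Adj v u := fun u v hne hh => by
    by_contra h2
    exact hh ((hT.2 u v hne).2 h2)
  have mix : ∀ {p q r : V}, DTri Adj p q r → ∀ v u w, v ∉ ({p, q, r} : Set V) →
      u ∈ ({p, q, r} : Set V) → w ∈ ({p, q, r} : Set V) → Adj u v → ¬ Adj v w :=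
    fun ht v u w hv hu hw h1 h2 => hn (minor_of_mixed ht hv hu hw h1 h2)
  have h0 := h
  obtain ⟨ab, bc, ca⟩ := h
  have h0' := h'
  obtain ⟨ax, xy, ya⟩ := h'
  have m1 := mix h0
  have m2 := mix h0'
  simp only [Set.mem_insert_iff, Set.mem_singleton_iff] at m1 m2
  by_cases hxb : x = b
  · subst hxb
    refine ⟨rfl, ?_⟩
    by_contra hyc
    refine m1 y x a ?_ (by simp) (by simp) xy ya
    rintro (e | e | e)
    · subst e; exact irr _ ya
    · subst e; exact irr _ xy
    · exact hyc e
  · exfalso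
    have hxa : x ≠ a := by rintro rfl; exact irr _ ax
    have hxc : x ≠ c := by rintro rfl; exact asym _ _ ax ca
    have hx : ¬ (x = a ∨ x = b ∨ x = c) := by tauto
    have hbx : Adj b x := tot _ _ hxb (m1 x a b hx (by simp) (by simp) ax)
    have hya : y ≠ a := by rintro rfl; exact irr _ ya
    have hyb : y ≠ b := by rintro rfl; exact asym _ _ xy hbx
    have hyc : y ≠ c := by
      rintro rfl
      exact m1 x a y hx (by simp) (by simp) ax xy
    have hy : ¬ (y = a ∨ y = b ∨ y = c) := by tauto
    have hyb' : Adj y b := tot _ _ hyb.symm (fun hb => m1 y b a hy (by simp) (by simp) hb ya)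
    have hba : b ≠ a := by rintro rfl; exact irr _ ab
    exact m2 b y x (by
      rintro (e | e | e)
      · exact hba e
      · exact hxb e.symm
      · exact hyb e.symm) (by simp) (by simp) hyb' hbx

theorem acyclicOn_of_no_dtri {V : Type} {Adj : V → V → Prop} (hT : IsTournament Adj)
    (S : Set V) (h : ∀ a ∈ S, ∀ b ∈ S, ∀ c ∈ S, ¬ DTri Adj a b c) : AcyclicOn Adj S := by
  have irr : ∀ v, ¬ Adj v v := fun v hv => by
    have := hT.1
    first
      | exact this v hv
      | exact this.irrefl v hv
  have key : ∀ u v, Relation.TransGen (fun a b => a ∈ S ∧ b ∈ S ∧ Adj a b) u v →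
      u ∈ S ∧ v ∈ S ∧ Adj u v := by
    intro u v huv
    induction huv with
    | single h1 => exact h1
    | @tail b c _ h2 ih =>
      obtain ⟨hu, hb, hub⟩ := ih
      obtain ⟨_, hc, hbc⟩ := h2
      refine ⟨hu, hc, ?_⟩
      by_cases e : u = c
      · subst e
        have hne : u ≠ b := by rintro rfl; exact irr _ hub
        exact absurd hbc ((hT.2 u b hne).1 hub)
      · exact (hT.2 u c e).2 (fun hcu => h u hu b hb c hc ⟨hub, hbc, hcu⟩)
  intro v _ hv
  exact irr v (key v v hv).2.2

/-- every tournament with dichromatic number at least `3`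
contains a strong `K⃗ 2` minor. -/
theorem tournament_chi_ge_three_strong_K2_minor
    {V : Type} [Fintype V] (Adj : V → V → Prop) (hT : IsTournament Adj)
    (hchi : 3 ≤ dichromaticNumberOn Adj Set.univ) :
    ContainsStrongCompleteMinor Adj 2 := by
  classical
  by_contra hn
  have irr : ∀ v, ¬ Adj v v := fun v hv => by
    have := hT.1
    first
      | exact this v hv
      | exact this.irrefl v hv
  have e := Fintype.equivFin V
  have h2 : DiColorableOn Adj Set.univ 2 := by
    let P : V → Prop := fun v => ∃ x y, DTri Adj v x y ∧ e v < e x ∧ e v < e y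
    have hP : ∀ {a b c}, DTri Adj a b c → P a → e a < e b ∧ e a < e c := by
      rintro a b c h ⟨x, y, h', h1, h2⟩
      obtain ⟨rfl, rfl⟩ := dtri_unique hT hn h h'
      exact ⟨h1, h2⟩
    refine ⟨fun v => if P v then 1 else 0, ?_, ?_⟩
    · intro v _
      dsimp only
      split_ifs <;> omega
    · intro i
      apply acyclicOn_of_no_dtri hT
      rintro a ⟨-, ha⟩ b ⟨-, hb⟩ c ⟨-, hc⟩ h
      have hb' : DTri Adj b c a := ⟨h.2.1, h.2.2, h.1⟩
      have hc' : DTri Adj c a b := ⟨h.2.2, h.1, h.2.1⟩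
      by_cases pa : P a
      · have pb : P b := by
          by_contra pb
          simp only [pa, pb, if_true, if_false] at ha hb
          omega
        exact lt_asymm (hP h pa).1 (hP hb' pb).2
      · have pb : ¬ P b := by
          intro pb
          simp only [pa, pb, if_true, if_false] at ha hb
          omega
        have pc : ¬ P c := by
          intro pc
          simp only [pa, pc, if_true, if_false] at ha hc
          omega
        have nab : e a ≠ e b := fun q => by
          have := e.injective q
          subst this; exact irr _ h.1
        have nbc : e b ≠ e c := fun q => by
          have := e.injective q
          subst this; exact irr _ h.2.1
        have nca : e c ≠ e a := fun q => by
          have := e.injective q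
          subst this; exact irr _ h.2.2
        have qa : ¬ (e a < e b ∧ e a < e c) := fun q => pa ⟨b, c, h, q⟩
        have qb : ¬ (e b < e c ∧ e b < e a) := fun q => pb ⟨c, a, hb', q⟩
        have qc : ¬ (e c < e a ∧ e c < e b) := fun q => pc ⟨a, b, hc', q⟩
        omega
  have : dichromaticNumberOn Adj Set.univ ≤ 2 := Nat.sInf_le h2
  omega
end

section
/- There exists a constant C' > 0 such that for every positive integer r, every tournament T that is ⌈C'·r·√(log r)⌉-strongly-connected contains a strong K⃗_r minor, i.e. sm(T) ≥ r. -/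
section TSMenger
open Relation

def TSAv {V : Type} (R : V → V → Prop) (X : Set V) (a b : V) : Prop := a ∉ X ∧ b ∉ X ∧ R a b
def TSIn {V : Type} (R : V → V → Prop) (P : Set V) (a b : V) : Prop := a ∈ P ∧ b ∈ P ∧ R a b

theorem ts_swap {V : Type} {R R' : V → V → Prop} (h : ∀ a b, R a b → R' b a) {u v : V}
    (hr : ReflTransGen R u v) : ReflTransGen R' v u := by
  induction hr with
  | refl => exact .refl
  | tail _ hbc ih => exact .head (h _ _ hbc) ih

theorem ts_mono {V : Type} {R R' : V → V → Prop} {u v : V}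
    (hr : ReflTransGen R u v) (h : ∀ a b, R a b → R' a b) : ReflTransGen R' u v := by
  induction hr with
  | refl => exact .refl
  | tail _ hbc ih => exact .tail ih (h _ _ hbc)

theorem ts_in_mono {V : Type} {R : V → V → Prop} {P Q : Set V} (h : P ⊆ Q) {u v : V}
    (hr : ReflTransGen (TSIn R P) u v) : ReflTransGen (TSIn R Q) u v :=
  ts_mono hr fun _ _ hab => ⟨h hab.1, h hab.2.1, hab.2.2⟩

theorem ts_av_end {V : Type} {R : V → V → Prop} {X : Set V} {u v : V} (hu : u ∉ X)
    (hr : ReflTransGen (TSAv R X) u v) : v ∉ X := by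
  induction hr with
  | refl => exact hu
  | tail _ hbc _ => exact hbc.2.1

theorem ts_hit {V : Type} {R : V → V → Prop} {X : Set V} (D : Set V) {u v : V}
    (h : ReflTransGen (TSAv R X) u v) :
    (∃ d ∈ D, ReflTransGen (fun a b => a ∉ D ∧ TSAv R X a b) u d) ∨
      (ReflTransGen (TSAv R (X ∪ D)) u v ∧ u ∉ D) := by
  induction h using ReflTransGen.head_induction_on with
  | refl =>
    by_cases hv : v ∈ D
    · exact .inl ⟨v, hv, .refl⟩
    · exact .inr ⟨.refl, hv⟩
  | @head a c hac _ ih =>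
    by_cases ha : a ∈ D
    · exact .inl ⟨a, ha, .refl⟩
    · rcases ih with ⟨d, hd, hr⟩ | ⟨hr, hc⟩
      · exact .inl ⟨d, hd, .head ⟨ha, hac⟩ hr⟩
      · refine .inr ⟨.head ⟨?_, ?_, hac.2.2⟩ hr, ha⟩
        · rintro (h | h); exacts [hac.1 h, ha h]
        · rintro (h | h); exacts [hac.2.1 h, hc h]

theorem ts_first {V : Type} {R : V → V → Prop} {P : Set V} (D : Set V) {u v : V}
    (h : ReflTransGen (TSIn R P) u v) (hv : v ∈ D) (hvP : v ∈ P) :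
    ∃ P' ⊆ P, ∃ d ∈ D, d ∈ P' ∧ u ∈ P' ∧ ReflTransGen (TSIn R P') u d ∧
      ∀ z ∈ P', ReflTransGen (fun a b => a ∉ D ∧ R a b) u z := by
  induction h using ReflTransGen.head_induction_on with
  | refl =>
    refine ⟨{v}, by simpa using hvP, v, hv, rfl, rfl, .refl, ?_⟩
    rintro z rfl; exact .refl
  | @head a c hac _ ih =>
    by_cases ha : a ∈ D
    · refine ⟨{a}, by simpa using hac.1, a, ha, rfl, rfl, .refl, ?_⟩
      rintro z rfl; exact .refl
    · obtain ⟨P', hP', d, hd, hdP, hcP, hr, hz⟩ := ih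
      refine ⟨insert a P', Set.insert_subset hac.1 hP', d, hd, .inr hdP, .inl rfl,
        .head ⟨.inl rfl, .inr hcP, hac.2.2⟩ (ts_in_mono (Set.subset_insert _ _) hr), ?_⟩
      rintro z (rfl | hz')
      · exact .refl
      · exact .head ⟨ha, hac.2.2⟩ (hz z hz')

/-- trim a connection to a set all of whose vertices lie between the ends -/
theorem ts_trim {V : Type} {R : V → V → Prop} {P : Set V} {u v : V}
    (h : ReflTransGen (TSIn R P) u v) (hvP : v ∈ P) :
    ∃ P' ⊆ P, u ∈ P' ∧ v ∈ P' ∧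
      ∀ z ∈ P', ReflTransGen (TSIn R P') u z ∧ ReflTransGen (TSIn R P') z v := by
  induction h using ReflTransGen.head_induction_on with
  | refl =>
    refine ⟨{v}, by simpa using hvP, rfl, rfl, ?_⟩
    rintro z rfl; exact ⟨.refl, .refl⟩
  | @head a c hac _ ih =>
    obtain ⟨P', hP', hcP, hvP', hz⟩ := ih
    have hsub := Set.subset_insert a P'
    have hstep : TSIn R (insert a P') a c := ⟨.inl rfl, .inr hcP, hac.2.2⟩
    refine ⟨insert a P', Set.insert_subset hac.1 hP', .inl rfl, .inr hvP', ?_⟩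
    rintro z (rfl | hz')
    · exact ⟨.refl, .head hstep (ts_in_mono hsub (hz c hcP).2)⟩
    · exact ⟨.head hstep (ts_in_mono hsub (hz z hz').1), ts_in_mono hsub (hz z hz').2⟩

theorem ts_side {V : Type} {R : V → V → Prop} {A B S : Set V} {x y : V} {k : ℕ}
    (H : ∀ X : Set V, X.ncard < k → ∃ u ∈ A, ∃ v ∈ B, u ∉ X ∧ ReflTransGen (TSAv R X) u v)
    (hS : ¬ ∃ u ∈ A, ∃ v ∈ B, u ∉ S ∧
      ReflTransGen (TSAv (fun a b => R a b ∧ ¬ (a = x ∧ b = y)) S) u v) :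
    k ≤ (insert x S).ncard ∧
    ∀ X : Set V, X.ncard < k → ∃ u ∈ A, ∃ d ∈ insert x S, u ∉ X ∧
      ReflTransGen (TSAv (fun a b => R a b ∧ ¬ (a = x ∧ b = y)) X) u d := by
  constructor
  · by_contra hlt
    obtain ⟨u, hu, v, hv, huX, hr⟩ := H _ (not_le.1 hlt)
    refine hS ⟨u, hu, v, hv, fun h => huX (.inr h), ts_mono hr ?_⟩
    rintro a b ⟨ha, hb, hab⟩
    exact ⟨fun h => ha (.inr h), fun h => hb (.inr h), hab, fun h => ha (.inl h.1)⟩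
  · intro X hX
    obtain ⟨u, hu, v, hv, huX, hr⟩ := H X hX
    rcases ts_hit (insert x S) hr with ⟨d, hd, hr'⟩ | ⟨hr', hu'⟩
    · refine ⟨u, hu, d, hd, huX, ts_mono hr' ?_⟩
      rintro a b ⟨ha, h1, h2, h3⟩
      exact ⟨h1, h2, h3, fun h => ha (.inl h.1)⟩
    · refine (hS ⟨u, hu, v, hv, fun h => hu' (.inr h), ts_mono hr' ?_⟩).elim
      rintro a b ⟨ha, hb, hab⟩
      exact ⟨fun h => ha (.inr (.inr h)), fun h => hb (.inr (.inr h)), hab,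
        fun h => ha (.inr (.inl h.1))⟩

theorem ts_pigeon {V : Type} [Finite V] {k : ℕ} {D : Set V} (hD : D.ncard ≤ k)
    {P : Fin k → Set V} (hP : ∀ i j, i ≠ j → Disjoint (P i) (P j)) {d : Fin k → V}
    (hd : ∀ i, d i ∈ D) (hdP : ∀ i, d i ∈ P i) :
    (∀ z ∈ D, ∃ i, d i = z) ∧ ∀ i, ∀ z ∈ D, z ∈ P i → z = d i := by
  have inj : Function.Injective d := by
    intro i j hij
    by_contra hne
    exact Set.disjoint_left.1 (hP i j hne) (hdP i) (hij ▸ hdP j)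
  have hr : Set.range d = D := by
    refine Set.eq_of_subset_of_ncard_le (by rintro _ ⟨i, rfl⟩; exact hd i) ?_ (Set.toFinite _)
    rw [← Set.image_univ, Set.ncard_image_of_injective _ inj, Set.ncard_univ]
    simpa using hD
  have h1 : ∀ z ∈ D, ∃ i, d i = z := fun z hz => by
    have : z ∈ Set.range d := hr ▸ hz
    exact this
  refine ⟨h1, fun i z hz hzP => ?_⟩
  obtain ⟨j, rfl⟩ := h1 z hz
  by_contra hne
  have : i ≠ j := fun h => hne (by rw [h])
  exact Set.disjoint_left.1 (hP i j this) hzP (hdP j)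

theorem ts_menger {V : Type} [Finite V] (k : ℕ) : ∀ (n : ℕ) (R : V → V → Prop) (A B : Set V),
    {p : V × V | R p.1 p.2}.ncard = n →
    (∀ X : Set V, X.ncard < k → ∃ u ∈ A, ∃ v ∈ B, u ∉ X ∧ ReflTransGen (TSAv R X) u v) →
    ∃ P : Fin k → Set V, (∀ i j, i ≠ j → Disjoint (P i) (P j)) ∧
      ∀ i, ∃ u ∈ A, ∃ v ∈ B, u ∈ P i ∧ v ∈ P i ∧ ReflTransGen (TSIn R (P i)) u v := by
  intro n
  induction n with
  | zero =>
    intro R A B hn H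
    have hR : ∀ a b, ¬ R a b := by
      intro a b hab
      rw [Set.ncard_eq_zero (Set.toFinite _)] at hn
      have : (a, b) ∈ {p : V × V | R p.1 p.2} := hab
      rw [hn] at this; exact this
    have hk : k ≤ (A ∩ B).ncard := by
      by_contra hlt
      obtain ⟨u, hu, v, hv, huX, hr⟩ := H _ (not_le.1 hlt)
      rcases ReflTransGen.cases_head hr with rfl | ⟨c, hc, _⟩
      · exact huX ⟨hu, hv⟩
      · exact hR _ _ hc.2.2
    have : Fintype.card (Fin k) ≤ Nat.card ↑(A ∩ B) := by
      rw [Fintype.card_fin, Nat.card_coe_set_eq]; exact hk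
    classical
    let inst : Fintype ↑(A ∩ B) := Fintype.ofFinite _
    rw [Nat.card_eq_fintype_card] at this
    obtain ⟨f⟩ := Function.Embedding.nonempty_of_card_le this
    refine ⟨fun i => {(f i : V)}, fun i j hij => ?_, fun i =>
      ⟨f i, (f i).2.1, f i, (f i).2.2, rfl, rfl, .refl⟩⟩
    rw [Set.disjoint_singleton]
    exact fun h => hij (f.injective (Subtype.ext h))
  | succ n ih =>
    intro R A B hn H
    obtain ⟨⟨x, y⟩, hxy⟩ : {p : V × V | R p.1 p.2}.Nonempty := by
      rw [← Set.ncard_pos (Set.toFinite _)]; omega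
    set R' : V → V → Prop := fun a b => R a b ∧ ¬ (a = x ∧ b = y) with hR'
    have hn' : {p : V × V | R' p.1 p.2}.ncard = n := by
      have : {p : V × V | R' p.1 p.2} = {p : V × V | R p.1 p.2} \ {(x, y)} := by
        ext ⟨a, b⟩; simp [hR']
      rw [this, Set.ncard_sdiff_singleton_of_mem hxy]; omega
    have hRR : ∀ P : Set V, ∀ a b, TSIn R' P a b → TSIn R P a b :=
      fun P a b h => ⟨h.1, h.2.1, h.2.2.1⟩
    by_cases hc : ∀ X : Set V, X.ncard < k →
        ∃ u ∈ A, ∃ v ∈ B, u ∉ X ∧ ReflTransGen (TSAv R' X) u v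
    · obtain ⟨P, hP, h⟩ := ih R' A B hn' hc
      refine ⟨P, hP, fun i => ?_⟩
      obtain ⟨u, hu, v, hv, h1, h2, h3⟩ := h i
      exact ⟨u, hu, v, hv, h1, h2, ts_mono h3 (hRR _)⟩
    push Not at hc
    obtain ⟨S, hSk, hS⟩ := hc
    have hS1 : ¬ ∃ u ∈ A, ∃ v ∈ B, u ∉ S ∧ ReflTransGen (TSAv R' S) u v := by
      rintro ⟨u, hu, v, hv, h1, h2⟩; exact hS u hu v hv h1 h2
    obtain ⟨hkx, hX⟩ := ts_side H hS1
    have Hs : ∀ X : Set V, X.ncard < k →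
        ∃ u ∈ B, ∃ v ∈ A, u ∉ X ∧ ReflTransGen (TSAv (fun a b => R b a) X) u v := by
      intro X hX
      obtain ⟨u, hu, v, hv, h1, h2⟩ := H X hX
      exact ⟨v, hv, u, hu, ts_av_end h1 h2, ts_swap (fun a b h => ⟨h.2.1, h.1, h.2.2⟩) h2⟩
    have hS2 : ¬ ∃ u ∈ B, ∃ v ∈ A, u ∉ S ∧
        ReflTransGen (TSAv (fun a b => R b a ∧ ¬ (a = y ∧ b = x)) S) u v := by
      rintro ⟨u, hu, v, hv, h1, h2⟩
      exact hS v hv u hu (ts_av_end h1 h2)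
        (ts_swap (fun a b h => ⟨h.2.1, h.1, h.2.2.1, fun h' => h.2.2.2 h'.symm⟩) h2)
    obtain ⟨hky, hY⟩ := ts_side Hs hS2
    have hxS : x ∉ S := by
      intro h; rw [Set.insert_eq_of_mem h] at hkx; omega
    have hyS : y ∉ S := by
      intro h; rw [Set.insert_eq_of_mem h] at hky; omega
    have hDx : (insert x S).ncard ≤ k := by
      rw [Set.ncard_insert_of_notMem hxS]; omega
    have hDy : (insert y S).ncard ≤ k := by
      rw [Set.ncard_insert_of_notMem hyS]; omega
    obtain ⟨P0, hP0, hP0'⟩ := ih R' A (insert x S) hn' hX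
    obtain ⟨Q0, hQ0, hQ0'⟩ := ih R' (insert y S) B hn' (by
      intro X hXk
      obtain ⟨u, hu, v, hv, h1, h2⟩ := hY X hXk
      exact ⟨v, hv, u, hu, ts_av_end h1 h2,
        ts_swap (fun a b h => ⟨h.2.1, h.1, h.2.2.1, fun h' => h.2.2.2 h'.symm⟩) h2⟩)
    have e1 : ∀ i, ∃ P' ⊆ P0 i, ∃ u ∈ A, ∃ d ∈ insert x S, d ∈ P' ∧ u ∈ P' ∧
        ReflTransGen (TSIn R' P') u d ∧
        ∀ z ∈ P', ReflTransGen (fun a b => a ∉ insert x S ∧ R' a b) u z := by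
      intro i
      obtain ⟨u, hu, v, hv, h1, h2, h3⟩ := hP0' i
      obtain ⟨P', hP', d, hd, h⟩ := ts_first (insert x S) h3 hv h2
      exact ⟨P', hP', u, hu, d, hd, h⟩
    have e2 : ∀ i, ∃ Q' ⊆ Q0 i, ∃ v ∈ B, ∃ d ∈ insert y S, d ∈ Q' ∧ v ∈ Q' ∧
        ReflTransGen (TSIn R' Q') d v ∧
        ∀ z ∈ Q', ReflTransGen (fun a b => b ∉ insert y S ∧ R' a b) z v := by
      intro i
      obtain ⟨u, hu, v, hv, h1, h2, h3⟩ := hQ0' i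
      have h3' : ReflTransGen (TSIn (fun a b => R' b a) (Q0 i)) v u :=
        ts_swap (fun a b h => ⟨h.2.1, h.1, h.2.2⟩) h3
      obtain ⟨P', hP', d, hd, hdP, hvP, hr, hz⟩ := ts_first (insert y S) h3' hu h1
      exact ⟨P', hP', v, hv, d, hd, hdP, hvP,
        ts_swap (fun a b h => ⟨h.2.1, h.1, h.2.2⟩) hr,
        fun z hz' => ts_swap (fun a b h => h) (hz z hz')⟩
    choose P hPs u hu d hd hdP huP hPr hPz using e1
    choose Q hQs v hv w hw hwQ hvQ hQr hQz using e2
    have hPd : ∀ i j, i ≠ j → Disjoint (P i) (P j) :=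
      fun i j h => (hP0 i j h).mono (hPs i) (hPs j)
    have hQd : ∀ i j, i ≠ j → Disjoint (Q i) (Q j) :=
      fun i j h => (hQ0 i j h).mono (hQs i) (hQs j)
    obtain ⟨-, pd⟩ := ts_pigeon hDx hPd hd hdP
    obtain ⟨pw', pw⟩ := ts_pigeon hDy hQd hw hwQ
    have cross : ∀ i j z, z ∈ P i → z ∈ Q j → z ∈ S ∧ z = d i ∧ z = w j := by
      intro i j z hzP hzQ
      have hzS : z ∈ S := by
        by_contra hzS
        have g1 : ReflTransGen (fun a b => a ∉ S ∧ R' a b) (u i) z :=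
          ts_mono (hPz i z hzP) fun a b h => ⟨fun h' => h.1 (.inr h'), h.2⟩
        have g2 : ReflTransGen (fun a b => b ∉ S ∧ R' a b) z (v j) :=
          ts_mono (hQz j z hzQ) fun a b h => ⟨fun h' => h.1 (.inr h'), h.2⟩
        have k1 : u i ∉ S ∧ ReflTransGen (TSAv R' S) (u i) z := by
          clear hPz
          generalize u i = u0 at g1
          induction g1 using ReflTransGen.head_induction_on with
          | refl => exact ⟨hzS, .refl⟩
          | head hac _ ih => exact ⟨hac.1, .head ⟨hac.1, ih.1, hac.2⟩ ih.2⟩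
        have k2 : v j ∉ S ∧ ReflTransGen (TSAv R' S) z (v j) := by
          generalize v j = v0 at g2
          induction g2 with
          | refl => exact ⟨hzS, .refl⟩
          | tail _ hac ih => exact ⟨hac.1, .tail ih.2 ⟨ih.1, hac.1, hac.2⟩⟩
        exact hS1 ⟨u i, hu i, v j, hv j, k1.1, k1.2.trans k2.2⟩
      exact ⟨hzS, pd i z (.inr hzS) hzP, pw j z (.inr hzS) hzQ⟩
    classical
    have e3 : ∀ i, ∃ j, w j = if d i = x then y else d i := by
      intro i
      apply pw'
      split_ifs with h
      · exact .inl rfl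
      · exact (hd i).resolve_left h |> Or.inr
    choose τ hτ using e3
    have dinj : ∀ i j, d i = d j → i = j := by
      intro i j h
      by_contra hne
      exact Set.disjoint_left.1 (hPd i j hne) (hdP i) (h ▸ hdP j)
    have τinj : ∀ i j, τ i = τ j → i = j := by
      intro i j h
      apply dinj
      have := hτ i
      rw [h, hτ j] at this
      have hi := hd i
      have hj := hd j
      split_ifs at this with h1 h2 h2
      · rw [h1, h2]
      · exact absurd (this ▸ hi.resolve_left h2) hyS
      · exact absurd (this ▸ hj.resolve_left h1) hyS
      · exact this.symm
    have key : ∀ i j, i ≠ j → Disjoint (P i) (Q (τ j)) := by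
      intro i j hij
      rw [Set.disjoint_left]
      intro z hzP hzQ
      obtain ⟨hzS, h1, h2⟩ := cross i (τ j) z hzP hzQ
      rw [hτ j] at h2
      split_ifs at h2 with h
      · exact hyS (h2 ▸ hzS)
      · exact hij (dinj _ _ (h1.symm.trans h2))
    refine ⟨fun i => P i ∪ Q (τ i), fun i j hij => ?_, fun i => ?_⟩
    · rw [Set.disjoint_union_left, Set.disjoint_union_right, Set.disjoint_union_right]
      exact ⟨⟨hPd i j hij, key i j hij⟩, (key j i hij.symm).symm,
        hQd _ _ fun h => hij (τinj _ _ h)⟩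
    · refine ⟨u i, hu i, v (τ i), hv _, .inl (huP i), .inr (hvQ _), ?_⟩
      have g1 := ts_in_mono (Q := P i ∪ Q (τ i)) Set.subset_union_left (ts_mono (hPr i) (hRR _))
      have g2 := ts_in_mono (Q := P i ∪ Q (τ i)) Set.subset_union_right (ts_mono (hQr (τ i)) (hRR _))
      refine g1.trans (ReflTransGen.trans ?_ g2)
      have := hτ i
      split_ifs at this with h
      · rw [h, this]
        exact .single ⟨.inl (h ▸ hdP i), .inr (this ▸ hwQ _), hxy⟩
      · rw [this]

end TSMenger

section TSGreedy
open Relation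
open scoped Classical

theorem ts_mindeg {V : Type} {Adj : V → V → Prop} (hT : IsTournament Adj)
    (S : Finset V) (hS : S.Nonempty) :
    ∃ v ∈ S, 2 * (S.filter (fun x => Adj x v)).card ≤ S.card := by
  by_contra hcon
  push Not at hcon
  have h1 : ∑ v ∈ S, (S.filter (fun x => Adj x v)).card
      = ∑ v ∈ S, (S.filter (fun x => Adj v x)).card := by
    have := Finset.sum_card_bipartiteAbove_eq_sum_card_bipartiteBelow (s := S) (t := S) Adj
    simp only [Finset.bipartiteAbove, Finset.bipartiteBelow] at this
    exact this.symm
  have h2 : ∀ v ∈ S, (S.filter (fun x => Adj x v)).card + (S.filter (fun x => Adj v x)).card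
      ≤ S.card := by
    intro v _
    rw [← Finset.card_union_of_disjoint]
    · exact Finset.card_le_card (Finset.union_subset (Finset.filter_subset _ _)
        (Finset.filter_subset _ _))
    · rw [Finset.disjoint_left]
      intro x hx hx'
      have a1 := (Finset.mem_filter.1 hx).2
      have a2 := (Finset.mem_filter.1 hx').2
      by_cases h : x = v
      · subst h; exact hT.1 x a1
      · exact ((hT.2 x v h).1 a1) a2
  have h3 := Finset.sum_le_sum h2
  rw [Finset.sum_add_distrib, ← h1, ← two_mul, Finset.mul_sum] at h3
  have h4 := Finset.sum_lt_sum_of_nonempty hS hcon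
  omega

theorem ts_gadget {V : Type} {Adj : V → V → Prop} (hT : IsTournament Adj) (s : ℕ) :
    ∀ S : Finset V, S.Nonempty → ∃ A ⊆ S, ∃ a ∈ A, ∃ v ∈ A, A.card ≤ s + 1 ∧
      (∀ y ∈ A, y ≠ a → Adj a y) ∧ (∀ y ∈ A, y ≠ v → Adj y v) ∧
      2 * (S.filter (fun x => Adj x v)).card ≤ S.card ∧
      2 ^ (s + 1) * (S.filter (fun x => ∀ y ∈ A, Adj x y)).card ≤ S.card := by
  induction s with
  | zero =>
    intro S hS
    obtain ⟨v, hv, h⟩ := ts_mindeg hT S hS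
    refine ⟨{v}, by simpa using hv, v, by simp, v, by simp, by simp, by simp, by simp, h, ?_⟩
    simpa using h
  | succ s ih =>
    intro S hS
    obtain ⟨v, hv, h⟩ := ts_mindeg hT S hS
    rcases (S.filter (fun x => Adj x v)).eq_empty_or_nonempty with he | hne
    · refine ⟨{v}, by simpa using hv, v, by simp, v, by simp, by simp, by simp, by simp, h, ?_⟩
      simp [he]
    · obtain ⟨A, hA, a, ha, w, hw, hc, h1, h2, h3, h4⟩ := ih _ hne
      have hAv : ∀ y ∈ A, Adj y v := fun y hy => (Finset.mem_filter.1 (hA hy)).2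
      refine ⟨insert v A, ?_, a, Finset.mem_insert_of_mem ha, v, Finset.mem_insert_self _ _,
        ?_, ?_, ?_, h, ?_⟩
      · exact Finset.insert_subset hv (hA.trans (Finset.filter_subset _ _))
      · exact (Finset.card_insert_le _ _).trans (by omega)
      · intro y hy hya
        rcases Finset.mem_insert.1 hy with rfl | hy
        · exact hAv a ha
        · exact h1 y hy hya
      · intro y hy hya
        exact hAv y ((Finset.mem_insert.1 hy).resolve_left hya)
      · have : S.filter (fun x => ∀ y ∈ insert v A, Adj x y)
            = (S.filter (fun x => Adj x v)).filter (fun x => ∀ y ∈ A, Adj x y) := by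
          ext x; simp [and_assoc]
        rw [this, pow_succ]
        nlinarith

theorem ts_greedy {V α : Type} [Inhabited α] (f : α → Finset V) (s N : ℕ)
    (Q : ℕ → α → Finset V → Prop)
    (mono : ∀ i g u u', u ⊆ u' → Q i g u → Q i g u') (used0 : Finset V) (m : ℕ)
    (step : ∀ i < m, ∀ used, used.card ≤ N → ∃ g, Disjoint (f g) used ∧ (f g).card ≤ s ∧ Q i g used)
    (hN : used0.card + m * s ≤ N) :
    ∃ g : ℕ → α, (∀ i < m, Disjoint (f (g i)) used0) ∧
      (∀ i < m, ∀ j < m, i ≠ j → Disjoint (f (g i)) (f (g j))) ∧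
      (∀ i < m, (f (g i)).card ≤ s) ∧
      ∀ i < m, Q i (g i) (used0 ∪ (Finset.range m).biUnion fun j => f (g j)) := by
  induction m with
  | zero => exact ⟨fun _ => default, by simp, by simp, by simp, by simp⟩
  | succ m ih =>
    rw [add_mul, one_mul] at hN
    obtain ⟨g, h1, h2, h3, h4⟩ := ih (fun i hi => step i (by omega)) (by omega)
    set U := used0 ∪ (Finset.range m).biUnion fun j => f (g j) with hU
    have hUc : U.card ≤ N := by
      refine (Finset.card_union_le _ _).trans ?_
      have : ((Finset.range m).biUnion fun j => f (g j)).card ≤ (Finset.range m).card * s :=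
        Finset.card_biUnion_le_card_mul _ _ _ fun j hj => h3 j (Finset.mem_range.1 hj)
      rw [Finset.card_range] at this
      omega
    obtain ⟨x, hx1, hx2, hx3⟩ := step m (by omega) U hUc
    have hgm : ∀ i < m, Disjoint (f x) (f (g i)) := fun i hi =>
      hx1.mono_right ((Finset.subset_biUnion_of_mem (fun j => f (g j))
        (Finset.mem_range.2 hi)).trans Finset.subset_union_right)
    set g' : ℕ → α := fun i => if i = m then x else g i with hg'
    have e1 : g' m = x := by simp [hg']
    have e2 : ∀ i < m, g' i = g i := fun i hi => by simp [hg', hi.ne]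
    have hsub : U ⊆ used0 ∪ (Finset.range (m + 1)).biUnion fun j => f (g' j) := by
      apply Finset.union_subset_union_right
      intro z hz
      simp only [Finset.mem_biUnion, Finset.mem_range] at hz ⊢
      obtain ⟨j, hj, hz⟩ := hz
      exact ⟨j, by omega, by rw [e2 j hj]; exact hz⟩
    refine ⟨g', ?_, ?_, ?_, ?_⟩
    · intro i hi
      rcases Nat.lt_succ_iff_lt_or_eq.1 hi with h | rfl
      · rw [e2 i h]; exact h1 i h
      · rw [e1]; exact hx1.mono_right Finset.subset_union_left
    · intro i hi j hj hij
      rcases Nat.lt_succ_iff_lt_or_eq.1 hi with h | rfl <;>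
        rcases Nat.lt_succ_iff_lt_or_eq.1 hj with h' | rfl
      · rw [e2 i h, e2 j h']; exact h2 i h j h' hij
      · rw [e2 i h, e1]; exact (hgm i h).symm
      · rw [e2 j h', e1]; exact hgm j h'
      · exact (hij rfl).elim
    · intro i hi
      rcases Nat.lt_succ_iff_lt_or_eq.1 hi with h | rfl
      · rw [e2 i h]; exact h3 i h
      · rw [e1]; exact hx2
    · intro i hi
      rcases Nat.lt_succ_iff_lt_or_eq.1 hi with h | rfl
      · rw [e2 i h]; exact mono _ _ _ _ hsub (h4 i h)
      · have := mono _ _ _ _ hsub hx3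
        rw [e1]; exact this

/-- a small set `R ⊆ W` that is contained in none of the small sets `E i` -/
theorem ts_average {V ι : Type} (W : Finset V) (hW : W.Nonempty) (c : ℕ) (E : ι → Finset V)
    (hE : ∀ i, 2 ^ c * (E i ∩ W).card ≤ W.card) (t : ℕ) :
    ∀ I : Finset ι, I.card < 2 ^ (c * t) →
      ∃ R ⊆ W, R.card ≤ t ∧ ∀ i ∈ I, ∃ x ∈ R, x ∉ E i := by
  induction t with
  | zero =>
    intro I hI
    have : I = ∅ := by simpa using hI
    exact ⟨∅, by simp, by simp, by simp [this]⟩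
  | succ t ih =>
    intro I hI
    obtain ⟨x, hx, hxc⟩ : ∃ x ∈ W, 2 ^ c * (I.filter (fun i => x ∈ E i)).card ≤ I.card := by
      by_contra hcon
      push Not at hcon
      have h4 := Finset.sum_lt_sum_of_nonempty hW hcon
      have h1 : ∑ x ∈ W, (I.filter (fun i => x ∈ E i)).card
          = ∑ i ∈ I, (W.filter (fun x => x ∈ E i)).card := by
        have := Finset.sum_card_bipartiteAbove_eq_sum_card_bipartiteBelow (s := W) (t := I)
          (fun x i => x ∈ E i)
        simpa only [Finset.bipartiteAbove, Finset.bipartiteBelow] using this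
      have h2 : ∑ i ∈ I, 2 ^ c * (W.filter (fun x => x ∈ E i)).card ≤ ∑ i ∈ I, W.card := by
        refine Finset.sum_le_sum fun i _ => ?_
        have : W.filter (fun x => x ∈ E i) = E i ∩ W := by
          ext; simp [and_comm]
        rw [this]; exact hE i
      rw [← Finset.mul_sum, ← h1, Finset.mul_sum] at h2
      simp only [Finset.sum_const, smul_eq_mul] at h2 h4
      rw [mul_comm] at h4
      omega
    obtain ⟨R, hR, hRc, h⟩ := ih (I.filter (fun i => x ∈ E i)) (by
      rw [mul_add, mul_one, pow_add, mul_comm] at hI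
      exact Nat.lt_of_mul_lt_mul_left (hxc.trans_lt hI))
    refine ⟨insert x R, Finset.insert_subset hx hR, (Finset.card_insert_le _ _).trans (by omega),
      fun i hi => ?_⟩
    by_cases hxi : x ∈ E i
    · obtain ⟨y, hy, hy'⟩ := h i (Finset.mem_filter.2 ⟨hi, hxi⟩)
      exact ⟨y, Finset.mem_insert_of_mem hy, hy'⟩
    · exact ⟨x, Finset.mem_insert_self _ _, hxi⟩

end TSGreedy

section TSCore
open Relation
open scoped Classical

theorem ts_flip {V : Type} {Adj : V → V → Prop} (hT : IsTournament Adj) {x y : V} (hne : x ≠ y)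
    (h : ¬ Adj x y) : Adj y x := (hT.2 y x hne.symm).2 h

theorem ts_swap_tour {V : Type} {Adj : V → V → Prop} (hT : IsTournament Adj) :
    IsTournament (fun a b => Adj b a) :=
  ⟨fun x h => hT.1 x h, fun u v huv => hT.2 v u huv.symm⟩

theorem ts_core {V : Type} [Fintype V] {Adj : V → V → Prop} (hT : IsTournament Adj)
    (r t n : ℕ) (ht : 1 ≤ t) (hr : r < 2 ^ (t * t)) (hn0 : 0 < n) (hn : 48 * (r * t) ≤ n)
    (U : Finset V) (hU : 3 * n ≤ 4 * U.card) (A B C : Fin r → Finset V) (v w : Fin r → V)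
    (hAC : ∀ q, A q ⊆ C q) (hBC : ∀ q, B q ⊆ C q) (hCU : ∀ q, Disjoint (C q) U)
    (hCC : ∀ q q', q ≠ q' → Disjoint (C q) (C q'))
    (hvC : ∀ q, v q ∈ C q) (hwC : ∀ q, w q ∈ C q)
    (hwv : ∀ q, ∀ y ∈ C q, ReflTransGen (TSIn Adj (C q : Set V)) (w q) y ∧
      ReflTransGen (TSIn Adj (C q : Set V)) y (v q))
    (hBA : ∀ q, ∀ y ∈ B q, ∀ z ∈ A q, ReflTransGen (TSIn Adj (C q : Set V)) y z)
    (hv : ∀ q, 2 * (U.filter (fun x => Adj x (v q))).card ≤ n)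
    (hw : ∀ q, 2 * (U.filter (fun x => Adj (w q) x)).card ≤ n)
    (hE : ∀ q, 2 ^ (t + 4) * (U.filter (fun x => ∀ y ∈ A q, Adj x y)).card ≤ n)
    (hF : ∀ q, 2 ^ (t + 4) * (U.filter (fun x => ∀ y ∈ B q, Adj y x)).card ≤ n) :
    ContainsStrongCompleteMinor Adj r := by
  set E : Fin r → Finset V := fun q => U.filter (fun x => ∀ y ∈ A q, Adj x y) with hEd
  set F : Fin r → Finset V := fun q => U.filter (fun x => ∀ y ∈ B q, Adj y x) with hFd
  have h2t : 2 ≤ 2 ^ t := by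
    calc 2 = 2 ^ 1 := rfl
      _ ≤ 2 ^ t := Nat.pow_le_pow_right (by norm_num) ht
  have hE32 : ∀ q, 32 * (E q).card ≤ n := fun q => by
    have := hE q; rw [pow_add] at this; nlinarith
  have hF32 : ∀ q, 32 * (F q).card ≤ n := fun q => by
    have := hF q; rw [pow_add] at this; nlinarith
  have hUC : ∀ q x, x ∈ U → ∀ y ∈ C q, x ≠ y := fun q x hx y hy h =>
    Finset.disjoint_left.1 (hCU q) hy (h ▸ hx)
  have nE : ∀ q x, x ∈ U → x ∉ E q → ∃ y ∈ A q, Adj y x := by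
    intro q x hx hxE
    have : ¬ ∀ y ∈ A q, Adj x y := fun h => hxE (Finset.mem_filter.2 ⟨hx, h⟩)
    push Not at this
    obtain ⟨y, hy, h⟩ := this
    exact ⟨y, hy, ts_flip hT (hUC q x hx y (hAC q hy)) h⟩
  have nF : ∀ q x, x ∈ U → x ∉ F q → ∃ y ∈ B q, Adj x y := by
    intro q x hx hxE
    have : ¬ ∀ y ∈ B q, Adj y x := fun h => hxE (Finset.mem_filter.2 ⟨hx, h⟩)
    push Not at this
    obtain ⟨y, hy, h⟩ := this
    exact ⟨y, hy, ts_flip hT (hUC q x hx y (hBC q hy)).symm h⟩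
  let Q : Fin r → Finset V → Prop := fun q R => R ⊆ U ∧
    (∀ x ∈ R, (∃ y ∈ A q, Adj y x) ∧ ∃ y ∈ B q, Adj x y) ∧
    (∃ x ∈ R, Adj (v q) x) ∧ (∃ x ∈ R, Adj x (w q)) ∧
    ∀ q', ∃ x ∈ R, ∃ y ∈ A q', Adj y x
  have step : ∀ q : Fin r, ∀ used : Finset V, used.card ≤ r * (t + 2) →
      ∃ R : Finset V, Disjoint R used ∧ R.card ≤ t + 2 ∧ Q q R := by
    intro q used hused
    have hu16 : 16 * used.card ≤ n := by nlinarith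
    set W := U \ (used ∪ (E q ∪ F q)) with hW
    have hWc : 5 * n ≤ 8 * W.card := by
      have h1 := Finset.le_card_sdiff (used ∪ (E q ∪ F q)) U
      rw [← hW] at h1
      have h2 := Finset.card_union_le used (E q ∪ F q)
      have h3 := Finset.card_union_le (E q) (F q)
      have h4 := hE32 q
      have h5 := hF32 q
      omega
    have hWU : W ⊆ U := Finset.sdiff_subset
    have hWn : W.Nonempty := Finset.card_pos.1 (by omega)
    have hWx : ∀ x ∈ W, x ∉ used ∧ x ∉ E q ∧ x ∉ F q := by
      intro x hx
      have := (Finset.mem_sdiff.1 hx).2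
      simp only [Finset.mem_union, not_or] at this
      exact this
    obtain ⟨ρ, hρ, hρv⟩ : ∃ x ∈ W, x ∉ U.filter (fun x => Adj x (v q)) := by
      by_contra hcon
      push Not at hcon
      have := Finset.card_le_card (show W ⊆ _ from hcon)
      have := hv q
      omega
    obtain ⟨σ, hσ, hσw⟩ : ∃ x ∈ W, x ∉ U.filter (fun x => Adj (w q) x) := by
      by_contra hcon
      push Not at hcon
      have := Finset.card_le_card (show W ⊆ _ from hcon)
      have := hw q
      omega
    obtain ⟨R, hRW, hRc, hR⟩ := ts_average W hWn t E (by
      intro q'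
      have h1 := hE q'
      have h2 : (E q' ∩ W).card ≤ (E q').card := Finset.card_le_card Finset.inter_subset_left
      rw [pow_add] at h1
      have h3 : 2 ^ t * (E q' ∩ W).card ≤ 2 ^ t * (E q').card := Nat.mul_le_mul_left _ h2
      have h4 : 2 ^ t * 2 ^ 4 * (E q').card = 16 * (2 ^ t * (E q').card) := by ring
      change 2 ^ t * 2 ^ 4 * (E q').card ≤ n at h1
      omega) t Finset.univ (by simpa using hr)
    have hR'W : insert ρ (insert σ R) ⊆ W :=
      Finset.insert_subset hρ (Finset.insert_subset hσ hRW)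
    refine ⟨insert ρ (insert σ R), ?_, ?_, hR'W.trans hWU, ?_, ?_, ?_, ?_⟩
    · rw [Finset.disjoint_left]
      exact fun x hx => (hWx x (hR'W hx)).1
    · have h1 := Finset.card_insert_le ρ (insert σ R)
      have h2 := Finset.card_insert_le σ R
      omega
    · intro x hx
      have hx' := hR'W hx
      exact ⟨nE q x (hWU hx') (hWx x hx').2.1, nF q x (hWU hx') (hWx x hx').2.2⟩
    · refine ⟨ρ, by simp, ts_flip hT (hUC q ρ (hWU hρ) _ (hvC q)) fun h => hρv ?_⟩
      exact Finset.mem_filter.2 ⟨hWU hρ, h⟩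
    · refine ⟨σ, by simp, ts_flip hT (hUC q σ (hWU hσ) _ (hwC q)).symm fun h => hσw ?_⟩
      exact Finset.mem_filter.2 ⟨hWU hσ, h⟩
    · intro q'
      obtain ⟨x, hx, hxE⟩ := hR q' (Finset.mem_univ _)
      exact ⟨x, by simp [hx], nE q' x (hWU (hRW hx)) hxE⟩
  obtain ⟨g, -, hgd, -, hgQ⟩ := ts_greedy (V := V) (α := Finset V) id (t + 2) (r * (t + 2))
    (fun i R _ => ∀ h : i < r, Q ⟨i, h⟩ R) (fun _ _ _ _ _ h => h) ∅ r (by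
      intro i hi used hu
      obtain ⟨R, h1, h2, h3⟩ := step ⟨i, hi⟩ used hu
      exact ⟨R, h1, h2, fun _ => h3⟩) (by simp)
  have hQ : ∀ q : Fin r, Q q (g q) := fun q => hgQ q q.2 q.2
  refine ⟨fun q => (C q : Set V) ∪ (g q : Set V), fun q => ⟨v q, .inl (hvC q)⟩, ?_, ?_, ?_⟩
  · intro q q' hqq
    have d1 := hCC q q' hqq
    have d2 : Disjoint (g q) (g q') := hgd q q.2 q' q'.2 fun h => hqq (Fin.ext h)
    have d3 : Disjoint (C q) (g q') := (hCU q).mono_right (hQ q').1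
    have d4 : Disjoint (C q') (g q) := (hCU q').mono_right (hQ q).1
    rw [Set.disjoint_union_left, Set.disjoint_union_right, Set.disjoint_union_right]
    simp only [Finset.disjoint_coe]
    exact ⟨⟨d1, d3⟩, d4.symm, d2⟩
  · intro q
    obtain ⟨h1, h2, ⟨ρ, hρ, hρv⟩, ⟨σ, hσ, hσw⟩, -⟩ := hQ q
    set S : Set V := (C q : Set V) ∪ (g q : Set V) with hS
    have up : ∀ {a b}, ReflTransGen (TSIn Adj (C q : Set V)) a b → ReflTransGen (TSIn Adj S) a b :=
      fun h => ts_in_mono Set.subset_union_left h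
    have inC : ∀ x ∈ C q, x ∈ S := fun x hx => .inl hx
    have inR : ∀ x ∈ g q, x ∈ S := fun x hx => .inr hx
    have fromw : ∀ x ∈ S, ReflTransGen (TSIn Adj S) (w q) x := by
      rintro x (hx | hx)
      · exact up (hwv q x hx).1
      · obtain ⟨y, hy, hyx⟩ := (h2 x hx).1
        exact (up (hwv q y (hAC q hy)).1).tail ⟨inC _ (hAC q hy), inR _ hx, hyx⟩
    have tov : ∀ x ∈ S, ReflTransGen (TSIn Adj S) x (v q) := by
      rintro x (hx | hx)
      · exact up (hwv q x hx).2
      · obtain ⟨y, hy, hyx⟩ := (h2 x hx).2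
        exact .head ⟨inR _ hx, inC _ (hBC q hy), hyx⟩ (up (hwv q y (hBC q hy)).2)
    have vw : ReflTransGen (TSIn Adj S) (v q) (w q) := by
      obtain ⟨y, hy, hyx⟩ := (h2 ρ hρ).2
      obtain ⟨z, hz, hzx⟩ := (h2 σ hσ).1
      refine .head ⟨inC _ (hvC q), inR _ hρ, hρv⟩ (.head ⟨inR _ hρ, inC _ (hBC q hy), hyx⟩ ?_)
      refine (up (hBA q y hy z hz)).trans ?_
      exact .head ⟨inC _ (hAC q hz), inR _ hσ, hzx⟩ (.single ⟨inR _ hσ, inC _ (hwC q), hσw⟩)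
    intro a ha b hb
    exact ((tov a ha).trans vw).trans (fromw b hb)
  · intro q q' _
    obtain ⟨x, hx, y, hy, h⟩ := (hQ q').2.2.2.2 q
    exact ⟨y, .inl (hAC q hy), x, .inr hx, h⟩

theorem ts_family {V : Type} [Fintype V] {Adj : V → V → Prop} (hT : IsTournament Adj)
    (t m : ℕ) (used0 : Finset V) (h : used0.card + m * (t + 4) < Fintype.card V) :
    ∃ (A : ℕ → Finset V) (a v : ℕ → V), (∀ i < m, Disjoint (A i) used0) ∧
      (∀ i < m, ∀ j < m, i ≠ j → Disjoint (A i) (A j)) ∧ (∀ i < m, (A i).card ≤ t + 4) ∧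
      ∀ i < m, a i ∈ A i ∧ v i ∈ A i ∧
        (∀ y ∈ A i, ReflTransGen (TSIn Adj (A i : Set V)) (a i) y ∧
          ReflTransGen (TSIn Adj (A i : Set V)) y (v i)) ∧
        ∀ U : Finset V, Disjoint U (used0 ∪ (Finset.range m).biUnion A) →
          2 * (U.filter (fun x => Adj x (v i))).card ≤ Fintype.card V ∧
          2 ^ (t + 4) * (U.filter (fun x => ∀ y ∈ A i, Adj x y)).card ≤ Fintype.card V := by
  have hne : Nonempty V := Fintype.card_pos_iff.1 (by omega)
  obtain ⟨v0⟩ := hne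
  let inst : Inhabited (Finset V × V × V) := ⟨(∅, v0, v0)⟩
  obtain ⟨g, h1, h2, h3, h4⟩ := ts_greedy (V := V) (α := Finset V × V × V) (fun g => g.1) (t + 4)
    (Fintype.card V - 1)
    (fun _ g used => g.2.1 ∈ g.1 ∧ g.2.2 ∈ g.1 ∧
        (∀ y ∈ g.1, ReflTransGen (TSIn Adj (g.1 : Set V)) g.2.1 y ∧
          ReflTransGen (TSIn Adj (g.1 : Set V)) y g.2.2) ∧
        ∀ U : Finset V, Disjoint U used →
          2 * (U.filter (fun x => Adj x g.2.2)).card ≤ Fintype.card V ∧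
          2 ^ (t + 4) * (U.filter (fun x => ∀ y ∈ g.1, Adj x y)).card ≤ Fintype.card V)
    (fun i g u u' hu hq => ⟨hq.1, hq.2.1, hq.2.2.1, fun U hU => hq.2.2.2 U (hU.mono_right hu)⟩)
    used0 m (by
      intro i _ used hu
      have hpos : 0 < Fintype.card V := Fintype.card_pos_iff.2 ⟨v0⟩
      obtain ⟨A, hA, a, ha, v, hv, hc, k1, k2, k3, k4⟩ := ts_gadget hT (t + 3) usedᶜ (by
        rw [← Finset.card_pos, Finset.card_compl]; omega)
      refine ⟨(A, a, v), ?_, hc, ha, hv, ?_, ?_⟩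
      · exact Finset.disjoint_left.2 fun x hx => Finset.mem_compl.1 (hA hx)
      · intro y hy
        constructor
        · by_cases hya : y = a
          · rw [hya]
          · exact .single ⟨ha, hy, k1 y hy hya⟩
        · by_cases hya : y = v
          · rw [hya]
          · exact .single ⟨hy, hv, k2 y hy hya⟩
      · intro U hU
        have hUs : U ⊆ usedᶜ := fun x hx => Finset.mem_compl.2 (Finset.disjoint_left.1 hU hx)
        have hle := Finset.card_le_univ (usedᶜ)
        have c1 := Finset.card_le_card (Finset.filter_subset_filter (fun x => Adj x v) hUs)
        constructor
        · simp only; omega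
        · rw [show t + 3 + 1 = t + 4 from rfl] at k4
          refine le_trans (Nat.mul_le_mul_left _ (Finset.card_le_card ?_)) (k4.trans hle)
          intro x hx
          simp only [Finset.mem_filter] at hx ⊢
          exact ⟨hUs hx.1, hx.2⟩) (by omega)
  exact ⟨fun i => (g i).1, fun i => (g i).2.1, fun i => (g i).2.2, h1, h2, h3, h4⟩

end TSCore

section TSMain
open Relation
open scoped Classical

theorem ts_main {V : Type} [Fintype V] {Adj : V → V → Prop} (hT : IsTournament Adj)
    (r t K : ℕ) (hr0 : 1 ≤ r) (ht : 1 ≤ t) (hr : r < 2 ^ (t * t)) (hK : 2000 * (r * t) ≤ K)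
    (hconn : KStronglyConnectedOn Adj Set.univ K) : ContainsStrongCompleteMinor Adj r := by
  set n := Fintype.card V with hn
  have hKn : K + 1 ≤ n := by
    have := hconn.1
    rwa [Set.ncard_univ, Nat.card_eq_fintype_card] at this
  have hrt : r ≤ r * t := Nat.le_mul_of_pos_right _ ht
  set M := 8 * r with hM
  have hMs : M * (t + 4) ≤ 40 * (r * t) := by
    have : M * (t + 4) = 8 * (r * t) + 32 * r := by rw [hM]; ring
    omega
  obtain ⟨A, a, v, -, hAd, hAc, hA⟩ := ts_family hT t M ∅ (by
    rw [Finset.card_empty]; omega)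
  set GA := (Finset.range M).biUnion A with hGA
  have hGAc : GA.card ≤ 40 * (r * t) := by
    have : GA.card ≤ (Finset.range M).card * (t + 4) :=
      Finset.card_biUnion_le_card_mul _ _ _ fun j hj => hAc j (Finset.mem_range.1 hj)
    rw [Finset.card_range] at this
    omega
  obtain ⟨B, b, w, hBA, hBd, hBc, hB⟩ := ts_family (ts_swap_tour hT) t M GA (by omega)
  set GB := (Finset.range M).biUnion B with hGB
  have hGBc : GB.card ≤ 40 * (r * t) := by
    have : GB.card ≤ (Finset.range M).card * (t + 4) :=
      Finset.card_biUnion_le_card_mul _ _ _ fun j hj => hBc j (Finset.mem_range.1 hj)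
    rw [Finset.card_range] at this
    omega
  set G := GA ∪ GB with hG
  have hGc : G.card ≤ 80 * (r * t) := (Finset.card_union_le _ _).trans (by omega)
  have memA : ∀ i < M, ∀ x ∈ A i, x ∈ GA := fun i hi x hx =>
    Finset.mem_biUnion.2 ⟨i, Finset.mem_range.2 hi, hx⟩
  have memB : ∀ i < M, ∀ x ∈ B i, x ∈ GB := fun i hi x hx =>
    Finset.mem_biUnion.2 ⟨i, Finset.mem_range.2 hi, hx⟩
  have hAB : ∀ i < M, ∀ j < M, Disjoint (A i) (B j) := fun i hi j hj =>
    Finset.disjoint_left.2 fun x hx hx' => Finset.disjoint_left.1 (hBA j hj) hx' (memA i hi x hx)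
  have uniA : ∀ i < M, ∀ j < M, ∀ x, x ∈ A i → x ∈ A j → i = j := fun i hi j hj x h1 h2 => by
    by_contra hne
    exact Finset.disjoint_left.1 (hAd i hi j hj hne) h1 h2
  have uniB : ∀ i < M, ∀ j < M, ∀ x, x ∈ B i → x ∈ B j → i = j := fun i hi j hj x h1 h2 => by
    by_contra hne
    exact Finset.disjoint_left.1 (hBd i hi j hj hne) h1 h2
  set EA : Set V := Set.range (fun i : Fin M => a i) with hEA
  set EB : Set V := Set.range (fun i : Fin M => b i) with hEB
  have EAc : EA.ncard = M := by
    rw [hEA, ← Set.image_univ, Set.ncard_image_of_injective, Set.ncard_univ]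
    · simp
    · intro i j hij
      have hij' : a i = a j := hij
      exact Fin.ext (uniA i i.2 j j.2 (a i) (hA i i.2).1 (hij' ▸ (hA j j.2).1))
  have EBc : EB.ncard = M := by
    rw [hEB, ← Set.image_univ, Set.ncard_image_of_injective, Set.ncard_univ]
    · simp
    · intro i j hij
      have hij' : b i = b j := hij
      exact Fin.ext (uniB i i.2 j j.2 (b i) (hB i i.2).1 (hij' ▸ (hB j j.2).1))
  set Z : Set V := {x | x ∉ G ∨ x ∈ EA ∨ x ∈ EB} with hZ
  obtain ⟨P0, hP0d, hP0⟩ := ts_menger M _ (TSIn Adj Z) EB EA rfl (by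
    intro X hX
    obtain ⟨x, hx, hxX⟩ := Set.exists_mem_notMem_of_ncard_lt_ncard (hX.trans_eq EBc.symm)
    obtain ⟨y, hy, hyX⟩ := Set.exists_mem_notMem_of_ncard_lt_ncard (hX.trans_eq EAc.symm)
    refine ⟨x, hx, y, hy, hxX, ?_⟩
    have hc : (X ∪ Zᶜ).ncard ≤ K - 1 := by
      have h1 := Set.ncard_union_le X Zᶜ
      have h2 : Zᶜ.ncard ≤ (G : Set V).ncard := by
        apply Set.ncard_le_ncard _ (Set.toFinite _)
        intro z hz
        by_contra hzG
        exact hz (.inl hzG)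
      rw [Set.ncard_coe_finset] at h2
      omega
    have := hconn.2 (X ∪ Zᶜ) (Set.subset_univ _) hc (u := x)
      ⟨Set.mem_univ _, by
        rintro (h | h)
        · exact hxX h
        · exact h (.inr (.inr hx))⟩ (v := y)
      ⟨Set.mem_univ _, by
        rintro (h | h)
        · exact hyX h
        · exact h (.inr (.inl hy))⟩
    refine ts_mono this ?_
    rintro p q ⟨⟨_, hp⟩, ⟨_, hq⟩, hpq⟩
    simp only [Set.mem_union, Set.mem_compl_iff, not_or, not_not] at hp hq
    exact ⟨hp.1, hq.1, hp.2, hq.2, hpq⟩)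
  have e1 : ∀ i : Fin M, ∃ P : Set V, P ⊆ P0 i ∩ Z ∧ ∃ f : Fin M, ∃ g : Fin M, b f ∈ P ∧ a g ∈ P ∧
      ∀ z ∈ P, ReflTransGen (TSIn Adj P) (b f) z ∧ ReflTransGen (TSIn Adj P) z (a g) := by
    intro i
    obtain ⟨x, ⟨f, rfl⟩, y, ⟨g, rfl⟩, h1, h2, h3⟩ := hP0 i
    have h3' : ReflTransGen (TSIn Adj (P0 i ∩ Z)) (b f) (a g) :=
      ts_mono h3 fun p q h => ⟨⟨h.1, h.2.2.1⟩, ⟨h.2.1, h.2.2.2.1⟩, h.2.2.2.2⟩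
    obtain ⟨P, hP, k1, k2, k3⟩ := ts_trim h3' ⟨h2, .inr (.inl ⟨g, rfl⟩)⟩
    exact ⟨P, hP, f, g, k1, k2, k3⟩
  choose PS hPS f g hbP haP hPr using e1
  have hPd : ∀ i j, i ≠ j → Disjoint (PS i) (PS j) := fun i j h =>
    (hP0d i j h).mono (fun x hx => (hPS i hx).1) (fun x hx => (hPS j hx).1)
  obtain ⟨-, pigB⟩ := ts_pigeon EBc.le hPd (d := fun i => b (f i)) (fun i => ⟨f i, rfl⟩) hbP
  obtain ⟨-, pigA⟩ := ts_pigeon EAc.le hPd (d := fun i => a (g i)) (fun i => ⟨g i, rfl⟩) haP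
  set P : Fin M → Finset V := fun i => (PS i).toFinite.toFinset with hP
  have memP : ∀ i x, x ∈ P i ↔ x ∈ PS i := fun i x => by simp [hP]
  have coeP : ∀ i, (P i : Set V) = PS i := fun i => by simp [hP]
  have hPd' : ∀ i j, i ≠ j → Disjoint (P i) (P j) := fun i j h =>
    Finset.disjoint_left.2 fun x hx hx' =>
      Set.disjoint_left.1 (hPd i j h) ((memP i x).1 hx) ((memP j x).1 hx')
  have hPsum : ∑ i, (P i).card ≤ n := by
    rw [← Finset.card_biUnion (fun i _ j _ h => hPd' i j h)]
    exact Finset.card_le_univ _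
  -- choose `r` short paths
  obtain ⟨ι, hι⟩ : ∃ ι : Fin r ↪ Fin M, ∀ q, 7 * r * (P (ι q)).card ≤ n := by
    set sm := Finset.univ.filter (fun i : Fin M => 7 * r * (P i).card ≤ n) with hsm
    have hcard : r ≤ sm.card := by
      by_contra hlt
      set bg := Finset.univ.filter (fun i : Fin M => ¬ 7 * r * (P i).card ≤ n) with hbg
      have h1 : sm.card + bg.card = M := by
        have := Finset.card_filter_add_card_filter_not (s := (Finset.univ : Finset (Fin M)))
          (fun i : Fin M => 7 * r * (P i).card ≤ n)
        rw [Finset.card_univ, Fintype.card_fin] at this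
        exact this
      have h2 : bg.card * (n + 1) ≤ ∑ i ∈ bg, 7 * r * (P i).card := by
        rw [← smul_eq_mul]
        apply Finset.card_nsmul_le_sum
        intro i hi
        have := (Finset.mem_filter.1 hi).2
        omega
      have h3 : ∑ i ∈ bg, 7 * r * (P i).card ≤ 7 * r * n := by
        rw [← Finset.mul_sum]
        exact Nat.mul_le_mul_left _ ((Finset.sum_le_sum_of_subset (Finset.subset_univ _)).trans hPsum)
      have h4 : 7 * r + 1 ≤ bg.card := by omega
      have h5 := Nat.mul_le_mul_right (n + 1) h4
      have h6 : (7 * r + 1) * (n + 1) = 7 * r * n + n + 7 * r + 1 := by ring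
      omega
    have : Fintype.card (Fin r) ≤ Fintype.card sm := by simpa using hcard
    obtain ⟨e⟩ := Function.Embedding.nonempty_of_card_le this
    exact ⟨e.trans (Function.Embedding.subtype _), fun q => (Finset.mem_filter.1 (e q).2).2⟩
  have hιn : ∀ q q', q ≠ q' → ι q ≠ ι q' := fun q q' h h' => h (ι.injective h')
  set PP := Finset.univ.biUnion (fun q => P (ι q)) with hPP
  have hPPc : 7 * PP.card ≤ n := by
    have h1 : PP.card ≤ ∑ q, (P (ι q)).card := Finset.card_biUnion_le
    have h2 : ∑ q, 7 * r * (P (ι q)).card ≤ r * n := by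
      have := Finset.sum_le_card_nsmul (Finset.univ : Finset (Fin r)) _ n (fun q _ => hι q)
      simpa using this
    rw [← Finset.mul_sum] at h2
    have h3 : r * (7 * PP.card) ≤ r * n := by
      refine le_trans ?_ h2
      rw [← mul_assoc, mul_comm r 7]
      exact Nat.mul_le_mul_left _ h1
    exact Nat.le_of_mul_le_mul_left h3 hr0
  set U := (G ∪ PP)ᶜ with hU
  have hUc : 3 * n ≤ 4 * U.card := by
    have h1 := Finset.card_compl_add_card (G ∪ PP)
    have h2 := Finset.card_union_le G PP
    rw [← hU] at h1
    omega
  have hUG : Disjoint U G := Finset.disjoint_left.2 fun x hx hxG =>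
    (Finset.mem_compl.1 hx) (Finset.mem_union_left _ hxG)
  have hUP : ∀ q, Disjoint U (P (ι q)) := fun q => Finset.disjoint_left.2 fun x hx hxG =>
    (Finset.mem_compl.1 hx) (Finset.mem_union_right _
      (Finset.mem_biUnion.2 ⟨q, Finset.mem_univ _, hxG⟩))
  have ginj : ∀ i j, i ≠ j → (g i : ℕ) ≠ g j := fun i j h h' =>
    Set.disjoint_left.1 (hPd i j h) (haP i) (by rw [h']; exact haP j)
  have finj : ∀ i j, i ≠ j → (f i : ℕ) ≠ f j := fun i j h h' =>
    Set.disjoint_left.1 (hPd i j h) (hbP i) (by rw [h']; exact hbP j)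
  have AP : ∀ i j, i ≠ j → Disjoint (A (g i)) (P j) := by
    intro i j hij
    refine Finset.disjoint_left.2 fun x hx hxP => ?_
    have hxP' := (memP j x).1 hxP
    rcases (hPS j hxP').2 with h | h | h
    · exact h (Finset.mem_union_left _ (memA _ (g i).2 x hx))
    · have h1 := pigA j x h hxP'
      refine ginj i j hij (uniA _ (g i).2 _ (g j).2 x hx ?_)
      rw [h1]; exact (hA _ (g j).2).1
    · obtain ⟨l, rfl⟩ := h
      exact Finset.disjoint_left.1 (hAB _ (g i).2 l l.2) hx (hB l l.2).1
  have BP : ∀ i j, i ≠ j → Disjoint (B (f i)) (P j) := by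
    intro i j hij
    refine Finset.disjoint_left.2 fun x hx hxP => ?_
    have hxP' := (memP j x).1 hxP
    rcases (hPS j hxP').2 with h | h | h
    · exact h (Finset.mem_union_right _ (memB _ (f i).2 x hx))
    · obtain ⟨l, rfl⟩ := h
      exact Finset.disjoint_left.1 (hAB l l.2 _ (f i).2) (hA l l.2).1 hx
    · have h1 := pigB j x h hxP'
      refine finj i j hij (uniB _ (f i).2 _ (f j).2 x hx ?_)
      rw [h1]; exact (hB _ (f j).2).1
  set C : Fin r → Finset V := fun q => A (g (ι q)) ∪ (B (f (ι q)) ∪ P (ι q)) with hC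
  have CA : ∀ q, A (g (ι q)) ⊆ C q := fun q => Finset.subset_union_left
  have CB : ∀ q, B (f (ι q)) ⊆ C q := fun q =>
    Finset.subset_union_left.trans Finset.subset_union_right
  have CP : ∀ q, P (ι q) ⊆ C q := fun q =>
    Finset.subset_union_right.trans Finset.subset_union_right
  have rA : ∀ q, ∀ y ∈ A (g (ι q)), ReflTransGen (TSIn Adj (C q : Set V)) (a (g (ι q))) y ∧
      ReflTransGen (TSIn Adj (C q : Set V)) y (v (g (ι q))) := by
    intro q y hy
    have h := (hA _ (g (ι q)).2).2.2.1 y hy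
    exact ⟨ts_in_mono (Finset.coe_subset.2 (CA q)) h.1, ts_in_mono (Finset.coe_subset.2 (CA q)) h.2⟩
  have rB : ∀ q, ∀ y ∈ B (f (ι q)), ReflTransGen (TSIn Adj (C q : Set V)) (w (f (ι q))) y ∧
      ReflTransGen (TSIn Adj (C q : Set V)) y (b (f (ι q))) := by
    intro q y hy
    have h := (hB _ (f (ι q)).2).2.2.1 y hy
    exact ⟨ts_in_mono (Finset.coe_subset.2 (CB q))
        (ts_swap (fun p q h => ⟨h.2.1, h.1, h.2.2⟩) h.2),
      ts_in_mono (Finset.coe_subset.2 (CB q)) (ts_swap (fun p q h => ⟨h.2.1, h.1, h.2.2⟩) h.1)⟩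
  have rP : ∀ q, ∀ y ∈ P (ι q), ReflTransGen (TSIn Adj (C q : Set V)) (b (f (ι q))) y ∧
      ReflTransGen (TSIn Adj (C q : Set V)) y (a (g (ι q))) := by
    intro q y hy
    have h := hPr (ι q) y ((memP _ _).1 hy)
    have hs : PS (ι q) ⊆ (C q : Set V) := by
      rw [← coeP]; exact Finset.coe_subset.2 (CP q)
    exact ⟨ts_in_mono hs h.1, ts_in_mono hs h.2⟩
  have ba : ∀ q, ReflTransGen (TSIn Adj (C q : Set V)) (b (f (ι q))) (a (g (ι q))) := fun q =>
    (rP q _ ((memP _ _).2 (haP _))).1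
  have av : ∀ q, ReflTransGen (TSIn Adj (C q : Set V)) (a (g (ι q))) (v (g (ι q))) := fun q =>
    (rA q _ (hA _ (g (ι q)).2).1).2
  have wb : ∀ q, ReflTransGen (TSIn Adj (C q : Set V)) (w (f (ι q))) (b (f (ι q))) := fun q =>
    (rB q _ (hB _ (f (ι q)).2).1).1
  have hUA : Disjoint U (∅ ∪ GA) := by
    rw [Finset.empty_union]; exact hUG.mono_right Finset.subset_union_left
  refine ts_core hT r t n ht hr (by omega) (by omega) U hUc (fun q => A (g (ι q)))
    (fun q => B (f (ι q))) C (fun q => v (g (ι q))) (fun q => w (f (ι q))) CA CB ?_ ?_ ?_ ?_ ?_ ?_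
    ?_ ?_ ?_ ?_
  · intro q
    simp only [hC, Finset.disjoint_union_left]
    refine ⟨?_, ?_, (hUP q).symm⟩
    · exact (hUG.mono_right fun x hx => Finset.mem_union_left _ (memA _ (g (ι q)).2 x hx)).symm
    · exact (hUG.mono_right fun x hx => Finset.mem_union_right _ (memB _ (f (ι q)).2 x hx)).symm
  · intro q q' hqq
    have hne := hιn q q' hqq
    simp only [hC, Finset.disjoint_union_left, Finset.disjoint_union_right]
    exact ⟨⟨hAd _ (g (ι q)).2 _ (g (ι q')).2 (ginj _ _ hne), (hAB _ (g _).2 _ (f _).2).symm,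
        (AP _ _ hne.symm).symm⟩,
      ⟨hAB _ (g _).2 _ (f _).2, hBd _ (f _).2 _ (f _).2 (finj _ _ hne), (BP _ _ hne.symm).symm⟩,
      AP _ _ hne, BP _ _ hne, hPd' _ _ hne⟩
  · exact fun q => CA q (hA _ (g _).2).2.1
  · exact fun q => CB q (hB _ (f _).2).2.1
  · intro q y hy
    rcases Finset.mem_union.1 hy with hy | hy
    · exact ⟨((wb q).trans (ba q)).trans (rA q y hy).1, (rA q y hy).2⟩
    rcases Finset.mem_union.1 hy with hy | hy
    · exact ⟨(rB q y hy).1, ((rB q y hy).2.trans (ba q)).trans (av q)⟩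
    · exact ⟨(wb q).trans (rP q y hy).1, (rP q y hy).2.trans (av q)⟩
  · intro q y hy z hz
    exact ((rB q y hy).2.trans (ba q)).trans (rA q z hz).1
  · intro q; exact ((hA _ (g (ι q)).2).2.2.2 U hUA).1
  · intro q; exact ((hB _ (f (ι q)).2).2.2.2 U hUG).1
  · intro q; exact ((hA _ (g (ι q)).2).2.2.2 U hUA).2
  · intro q; exact ((hB _ (f (ι q)).2).2.2.2 U hUG).2

end TSMain

/-- there is a constant `C' > 0` such that every tournament
that is `⌈C' * r * √(log r)⌉`-strongly-connected contains a strong `K⃗ r`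
minor. -/
theorem tournament_high_connectivity_strong_minor :
    ∃ C' : ℝ, 0 < C' ∧
      ∀ (r : ℕ), 0 < r →
        ∀ (V : Type) [Fintype V] (Adj : V → V → Prop),
          IsTournament Adj →
          KStronglyConnectedOn Adj Set.univ ⌈C' * r * Real.sqrt (Real.log r)⌉₊ →
          ContainsStrongCompleteMinor Adj r := by
  refine ⟨6000, by norm_num, ?_⟩
  intro r hr0 V _ Adj hT hconn
  rcases Nat.lt_or_ge r 2 with hr1 | hr2
  · obtain rfl : r = 1 := by omega
    have h1 := hconn.1
    obtain ⟨x, -⟩ : (Set.univ : Set V).Nonempty := by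
      rw [← Set.ncard_pos (Set.toFinite _)]; omega
    refine ⟨fun _ => {x}, fun _ => ⟨x, rfl⟩, fun i j h => (h (Subsingleton.elim i j)).elim, ?_,
      fun i j h => (h (Subsingleton.elim i j)).elim⟩
    rintro _ u rfl v rfl
    exact .refl
  · set m := Nat.log 2 r with hm
    set t := Nat.sqrt m + 1 with ht
    have hrt : r < 2 ^ (t * t) := by
      refine (Nat.lt_pow_succ_log_self (b := 2) (by norm_num) r).trans_le ?_
      exact Nat.pow_le_pow_right (by norm_num) (Nat.lt_succ_sqrt m)
    refine ts_main hT r t _ hr0 (by omega) hrt ?_ hconn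
    have hlog2 : (1 / 2 : ℝ) ≤ Real.log 2 := by
      have := Real.log_two_gt_d9; linarith
    have hrpos : (0 : ℝ) < r := by exact_mod_cast hr0
    have hlr : Real.log 2 ≤ Real.log r := Real.log_le_log (by norm_num) (by exact_mod_cast hr2)
    have hml : (m : ℝ) * Real.log 2 ≤ Real.log r := by
      rw [← Real.log_pow]
      apply Real.log_le_log (by positivity)
      exact_mod_cast Nat.pow_log_le_self 2 (by omega : r ≠ 0)
    set L := Real.sqrt (Real.log r) with hL
    have hL0 : 0 ≤ L := Real.sqrt_nonneg _
    have hLL : L * L = Real.log r := Real.mul_self_sqrt (by linarith)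
    have hs : ((Nat.sqrt m : ℕ) : ℝ) * (Nat.sqrt m : ℕ) ≤ m := by
      exact_mod_cast Nat.sqrt_le m
    have hm0 : (0 : ℝ) ≤ m := Nat.cast_nonneg m
    have h1 : ((Nat.sqrt m : ℕ) : ℝ) ≤ 3 / 2 * L := by
      by_contra hcon
      push Not at hcon
      nlinarith
    have h2 : (1 : ℝ) ≤ 3 / 2 * L := by
      by_contra hcon
      push Not at hcon
      have := Real.log_two_gt_d9
      nlinarith
    have h3 : (t : ℝ) ≤ 3 * L := by rw [ht]; push_cast; linarith
    have h4 : ((2000 * (r * t) : ℕ) : ℝ) ≤ 6000 * r * L := by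
      push_cast; nlinarith
    exact_mod_cast h4.trans (Nat.le_ceil _)
end

section
/- Every tournament T on n vertices contains a 4-nearly-regular subset R ⊆ V(T) of size at least ⌊n/20⌋ such that, moreover, every vertex v ∈ R has in-degree at least n/6 and out-degree at least n/6 in T. -/
lemma sum_inDeg_bound {V : Type} [Fintype V] (Adj : V → V → Prop) (hT : IsTournament Adj)
    (A : Finset V) (hA : ∀ v ∈ A, 5 * inDeg Adj v + 2 ≤ Fintype.card V) :
    5 * A.card ≤ 2 * Fintype.card V + 1 := by
  classical
  have h1 : ∀ u v : V, (if Adj u v then 1 else 0) + (if Adj v u then 1 else 0)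
      + (if u = v then 1 else 0) = (1 : ℕ) := by
    intro u v
    by_cases h : u = v
    · subst h
      have := hT.1 u
      simp [this]
    · have := hT.2 u v h
      by_cases h2 : Adj v u <;> simp [h, h2, this]
  have h2 : ∑ u ∈ A, ∑ v ∈ A, ((if Adj u v then 1 else 0) + (if Adj v u then 1 else 0)
      + (if u = v then 1 else 0)) = A.card * A.card := by
    simp only [h1]
    simp
  have h3 : ∑ u ∈ A, ∑ v ∈ A, (if u = v then 1 else 0) = A.card := by
    simp
  have h4 : ∑ u ∈ A, ∑ v ∈ A, (if Adj u v then 1 else 0)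
      = ∑ u ∈ A, ∑ v ∈ A, (if Adj v u then 1 else 0) := Finset.sum_comm
  simp only [Finset.sum_add_distrib] at h2
  rw [h3, h4] at h2
  have h5 : ∀ u ∈ A, 5 * (∑ v ∈ A, (if Adj v u then 1 else 0)) + 2 ≤ Fintype.card V := by
    intro u hu
    refine le_trans ?_ (hA u hu)
    have : (∑ v ∈ A, (if Adj v u then 1 else 0)) ≤ inDeg Adj u := by
      rw [← Finset.card_filter, ← Set.ncard_coe_finset]
      apply Set.ncard_le_ncard _ (Set.toFinite _)
      intro x hx
      simp at hx
      exact hx.2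
    omega
  have h6 := Finset.sum_le_sum h5
  simp only [Finset.sum_add_distrib, ← Finset.mul_sum, Finset.sum_const, smul_eq_mul] at h6
  rcases Nat.eq_zero_or_pos A.card with h0 | h0
  · omega
  · by_contra hc
    push Not at hc
    have := Nat.mul_le_mul_left A.card hc
    nlinarith

lemma inDeg_add_outDeg {V : Type} [Fintype V] (Adj : V → V → Prop) (hT : IsTournament Adj)
    (v : V) : inDeg Adj v + outDeg Adj v + 1 = Fintype.card V := by
  classical
  have e : {w | Adj v w} = ({w | Adj w v} ∪ {v})ᶜ := by
    ext w
    by_cases h : v = w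
    · subst h
      have := hT.1 v
      simp [this]
    · have := hT.2 v w h
      simp [this, Ne.symm h]
  have h1 : ({w | Adj w v} ∪ {v}).ncard = inDeg Adj v + 1 := by
    rw [Set.ncard_union_eq, Set.ncard_singleton]
    · rfl
    · simpa using hT.1 v
  have h2 := Set.ncard_add_ncard_compl ({w | Adj w v} ∪ {v})
  rw [← e, h1, Nat.card_eq_fintype_card] at h2
  unfold outDeg
  omega

/-- every tournament on `n` vertices contains a
`4`-nearly-regular subset of size at least `⌊n / 20⌋` all of whose vertices
have in- and out-degree at least `n / 6`. -/
theorem tournament_nearly_regular_subset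
    {V : Type} [Fintype V] (Adj : V → V → Prop) (hT : IsTournament Adj) :
    ∃ R : Set V,
      Fintype.card V / 20 ≤ R.ncard ∧
      ((∀ v ∈ R, inDeg Adj v ≤ outDeg Adj v ∧ outDeg Adj v ≤ 4 * inDeg Adj v) ∨
       (∀ v ∈ R, outDeg Adj v ≤ inDeg Adj v ∧ inDeg Adj v ≤ 4 * outDeg Adj v)) ∧
      (∀ v ∈ R, (Fintype.card V : ℝ) / 6 ≤ (inDeg Adj v : ℝ) ∧
                (Fintype.card V : ℝ) / 6 ≤ (outDeg Adj v : ℝ)) := by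
  classical
  by_cases hn : Fintype.card V < 20
  · exact ⟨∅, by simp; omega, by simp, by simp⟩
  push Not at hn
  have hT' : IsTournament (fun a b => Adj b a) := ⟨fun a => hT.1 a, fun u v h => hT.2 v u h.symm⟩
  have hd := inDeg_add_outDeg Adj hT
  let A : Finset V := {v | 5 * inDeg Adj v + 2 ≤ Fintype.card V}
  let B : Finset V := {v | 5 * outDeg Adj v + 2 ≤ Fintype.card V}
  have hA := sum_inDeg_bound Adj hT A (by simp [A])
  have hB := sum_inDeg_bound (fun a b => Adj b a) hT' B (by
    intro v hv
    have : 5 * outDeg Adj v + 2 ≤ Fintype.card V := by simpa [B] using hv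
    exact this)
  let P : Finset V := {v | inDeg Adj v ≤ outDeg Adj v ∧ Fintype.card V ≤ 5 * inDeg Adj v + 1}
  let Q : Finset V := {v | outDeg Adj v ≤ inDeg Adj v ∧ Fintype.card V ≤ 5 * outDeg Adj v + 1}
  have hU : (Finset.univ : Finset V) ⊆ (A ∪ B) ∪ (P ∪ Q) := by
    intro v _
    simp only [Finset.mem_union, A, B, P, Q, Finset.mem_filter, Finset.mem_univ, true_and]
    omega
  have hc := Finset.card_le_card hU
  have c1 := Finset.card_union_le (A ∪ B) (P ∪ Q)
  have c2 := Finset.card_union_le A B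
  have c3 := Finset.card_union_le P Q
  rw [Finset.card_univ] at hc
  have key : Fintype.card V / 20 ≤ P.card ∨ Fintype.card V / 20 ≤ Q.card := by omega
  have cast6 : ∀ k : ℕ, Fintype.card V ≤ 6 * k → (Fintype.card V : ℝ) / 6 ≤ (k : ℝ) := by
    intro k hk
    have : (Fintype.card V : ℝ) ≤ 6 * k := by exact_mod_cast hk
    linarith
  rcases key with h | h
  · refine ⟨P, by rwa [Set.ncard_coe_finset], Or.inl ?_, ?_⟩ <;> intro v hv <;>
      have hv' : inDeg Adj v ≤ outDeg Adj v ∧ Fintype.card V ≤ 5 * inDeg Adj v + 1 := by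
        simpa [P] using hv
    · have := hd v
      omega
    · have := hd v
      exact ⟨cast6 _ (by omega), cast6 _ (by omega)⟩
  · refine ⟨Q, by rwa [Set.ncard_coe_finset], Or.inr ?_, ?_⟩ <;> intro v hv <;>
      have hv' : outDeg Adj v ≤ inDeg Adj v ∧ Fintype.card V ≤ 5 * outDeg Adj v + 1 := by
        simpa [Q] using hv
    · have := hd v
      omega
    · have := hd v
      exact ⟨cast6 _ (by omega), cast6 _ (by omega)⟩
end

section
/- Let D be a strongly connected digraph, let v be a vertex of D and let X ⊆ V(D). For each i ≥ 0 let L_i⁺ = {w ∈ V(D) : dist_D(v, w) = i} be the i-th out-layer from v, where dist_D(v, w) is the length of a shortest directed path from v to w. Then there exists i such that χ(D[L_i⁺ ∩ X]) ≥ χ(D[X]) / 2. The analogous statement holds for the in-layers L_i⁻ = {w ∈ V(D) : dist_D(w, v) = i}. -/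
/-- Directed distance: the length of a shortest directed walk from `u` to
`w` (as `sInf`, and hence `0` if there is none, which does not occur in a
strongly connected digraph). -/
noncomputable def ddist {V : Type} (Adj : V → V → Prop) (u w : V) : ℕ :=
  sInf {n | ∃ p : Fin (n + 1) → V, p 0 = u ∧ p (Fin.last n) = w ∧
    ∀ i : Fin n, Adj (p i.castSucc) (p i.succ)}

theorem exists_walk_snoc {V : Type} {Adj : V → V → Prop} {u a b : V} {n : ℕ} (hab : Adj a b)
    (h : ∃ p : Fin (n + 1) → V, p 0 = u ∧ p (Fin.last n) = a ∧
      ∀ i : Fin n, Adj (p i.castSucc) (p i.succ)) :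
    ∃ p : Fin (n + 1 + 1) → V, p 0 = u ∧ p (Fin.last (n + 1)) = b ∧
      ∀ i : Fin (n + 1), Adj (p i.castSucc) (p i.succ) := by
  obtain ⟨p, h0, hl, hp⟩ := h
  refine ⟨Fin.snoc (α := fun _ => V) p b, ?_, by simp, ?_⟩
  · have : (0 : Fin (n + 1 + 1)) = Fin.castSucc 0 := rfl
    rw [this, Fin.snoc_castSucc, h0]
  · intro i
    rw [Fin.snoc_castSucc]
    induction i using Fin.lastCases with
    | last => rw [Fin.succ_last, Fin.snoc_last, hl]; exact hab
    | cast j => rw [Fin.succ_castSucc, Fin.snoc_castSucc]; exact hp j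

theorem exists_walk_cons {V : Type} {Adj : V → V → Prop} {w a b : V} {n : ℕ} (hab : Adj a b)
    (h : ∃ p : Fin (n + 1) → V, p 0 = b ∧ p (Fin.last n) = w ∧
      ∀ i : Fin n, Adj (p i.castSucc) (p i.succ)) :
    ∃ p : Fin (n + 1 + 1) → V, p 0 = a ∧ p (Fin.last (n + 1)) = w ∧
      ∀ i : Fin (n + 1), Adj (p i.castSucc) (p i.succ) := by
  obtain ⟨p, h0, hl, hp⟩ := h
  refine ⟨Fin.cons (α := fun _ => V) a p, by simp, ?_, ?_⟩
  · rw [← Fin.succ_last, Fin.cons_succ, hl]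
  · intro i
    rw [Fin.cons_succ]
    induction i using Fin.cases with
    | zero => rw [Fin.castSucc_zero, Fin.cons_zero, h0]; exact hab
    | succ j => rw [← Fin.succ_castSucc, Fin.cons_succ]; exact hp j

theorem walk_set_nonempty {V : Type} {Adj : V → V → Prop}
    (hsc : StronglyConnectedOn Adj Set.univ) (u w : V) :
    {n | ∃ p : Fin (n + 1) → V, p 0 = u ∧ p (Fin.last n) = w ∧
      ∀ i : Fin n, Adj (p i.castSucc) (p i.succ)}.Nonempty := by
  have h := hsc (Set.mem_univ u) (Set.mem_univ w)
  induction h with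
  | refl => exact ⟨0, fun _ => u, rfl, rfl, fun i => i.elim0⟩
  | tail _ hbc ih =>
    obtain ⟨n, hn⟩ := ih
    exact ⟨n + 1, exists_walk_snoc hbc.2.2 hn⟩

theorem ddist_out {V : Type} {Adj : V → V → Prop}
    (hsc : StronglyConnectedOn Adj Set.univ) (v : V) {a b : V} (hab : Adj a b) :
    ddist Adj v b ≤ ddist Adj v a + 1 :=
  Nat.sInf_le (exists_walk_snoc hab (Nat.sInf_mem (walk_set_nonempty hsc v a)))

theorem ddist_in {V : Type} {Adj : V → V → Prop}
    (hsc : StronglyConnectedOn Adj Set.univ) (v : V) {a b : V} (hab : Adj a b) :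
    ddist Adj a v ≤ ddist Adj b v + 1 :=
  Nat.sInf_le (exists_walk_cons hab (Nat.sInf_mem (walk_set_nonempty hsc b v)))

theorem colorable_chi {V : Type} [Fintype V] {Adj : V → V → Prop} (hD : Irreflexive Adj)
    (S : Set V) : DiColorableOn Adj S (dichromaticNumberOn Adj S) := by
  refine Nat.sInf_mem (s := {k | DiColorableOn Adj S k})
    ⟨Fintype.card V, fun v => (Fintype.equivFin V v : ℕ), fun v _ => Fin.is_lt _, ?_⟩
  intro i v _ h
  obtain ⟨c, ⟨h1, h2, h3⟩, _⟩ := Relation.TransGen.head'_iff.1 h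
  have : v = c := (Fintype.equivFin V).injective (Fin.ext (h1.2.trans h2.2.symm))
  subst this
  exact hD v h3

/-- Main step, for a potential `g` which increases by at most one along every edge. -/
theorem half_chi_aux {V : Type} [Fintype V] (Adj : V → V → Prop) (hD : Irreflexive Adj)
    (X : Set V) (g : V → ℤ) (hg : ∀ a b, Adj a b → g b ≤ g a + 1) (v : V) :
    ∃ u : V, dichromaticNumberOn Adj X ≤
      2 * dichromaticNumberOn Adj ({w | g w = g u} ∩ X) := by
  haveI : Nonempty V := ⟨v⟩
  obtain ⟨u, hu⟩ := Finite.exists_max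
    (fun u : V => dichromaticNumberOn Adj ({w | g w = g u} ∩ X))
  refine ⟨u, Nat.sInf_le ?_⟩
  choose c hc hac using fun j : ℤ => colorable_chi hD ({w | g w = j} ∩ X)
  refine ⟨fun w => 2 * c (g w) w + (g w % 2).toNat, ?_, ?_⟩
  · intro w hw
    have h1 := hc (g w) w ⟨rfl, hw⟩
    have h2 := hu w
    simp only at h2 ⊢
    omega
  · intro i w hw hcyc
    have key : ∀ y, Relation.TransGen (fun a b =>
        a ∈ {z ∈ X | 2 * c (g z) z + (g z % 2).toNat = i} ∧
        b ∈ {z ∈ X | 2 * c (g z) z + (g z % 2).toNat = i} ∧ Adj a b) w y →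
        g y ≤ g w ∧ (g y = g w → Relation.TransGen (fun a b =>
          a ∈ {z ∈ {z | g z = g w} ∩ X | c (g w) z = c (g w) w} ∧
          b ∈ {z ∈ {z | g z = g w} ∩ X | c (g w) z = c (g w) w} ∧ Adj a b) w y) := by
      have step : ∀ a b, 2 * c (g a) a + (g a % 2).toNat = i →
          2 * c (g b) b + (g b % 2).toNat = i → Adj a b → g b ≤ g a := by
        intro a b ha hb hab
        have := hg a b hab
        omega
      have hww := hw.2
      have mem : ∀ a, a ∈ X → 2 * c (g a) a + (g a % 2).toNat = i → g a = g w →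
          a ∈ {z ∈ {z | g z = g w} ∩ X | c (g w) z = c (g w) w} := by
        intro a haX ha hga
        refine ⟨⟨hga, haX⟩, ?_⟩
        simp only at hww
        rw [hga] at ha
        omega
      intro y hy
      induction hy with
      | single h =>
        obtain ⟨h1, h2, h3⟩ := h
        exact ⟨step _ _ h1.2 h2.2 h3, fun e =>
          .single ⟨mem _ h1.1 h1.2 rfl, mem _ h2.1 h2.2 e, h3⟩⟩
      | tail _ h ih =>
        obtain ⟨h1, h2, h3⟩ := h
        have hs := step _ _ h1.2 h2.2 h3
        refine ⟨hs.trans ih.1, fun e => ?_⟩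
        have e' := le_antisymm ih.1 (e ▸ hs)
        exact (ih.2 e').tail ⟨mem _ h1.1 h1.2 e', mem _ h2.1 h2.2 e, h3⟩
    exact hac (g w) (c (g w) w) w ⟨⟨rfl, hw.1⟩, rfl⟩ ((key w hcyc).2 rfl)

/-- in a strongly connected digraph `D`, for every vertex `v`
and every vertex subset `X` there is an out-layer `L i⁺` from `v` with
`χ(D[L i⁺ ∩ X]) ≥ χ(D[X]) / 2`, and likewise an in-layer `L i⁻`. -/
theorem exists_layer_with_half_chi
    {V : Type} [Fintype V] (Adj : V → V → Prop) (hD : Irreflexive Adj)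
    (hsc : StronglyConnectedOn Adj Set.univ) (v : V) (X : Set V) :
    (∃ i : ℕ, dichromaticNumberOn Adj X ≤
        2 * dichromaticNumberOn Adj ({w | ddist Adj v w = i} ∩ X)) ∧
    (∃ i : ℕ, dichromaticNumberOn Adj X ≤
        2 * dichromaticNumberOn Adj ({w | ddist Adj w v = i} ∩ X)) := by
  constructor
  · obtain ⟨u, hu⟩ := half_chi_aux Adj hD X (fun w => (ddist Adj v w : ℤ))
      (fun a b hab => by exact_mod_cast ddist_out hsc v hab) v
    refine ⟨ddist Adj v u, ?_⟩
    simpa only [Nat.cast_inj] using hu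
  · obtain ⟨u, hu⟩ := half_chi_aux Adj hD X (fun w => -(ddist Adj w v : ℤ))
      (fun a b hab => by have := ddist_in hsc v hab; omega) v
    refine ⟨ddist Adj u v, ?_⟩
    simpa only [neg_inj, Nat.cast_inj] using hu
end

section
/- Let r ≥ 1 and 0 ≤ m ≤ r be integers. Every digraph D with dichromatic number χ(D) ≥ r·4^m contains an m-partial strong K⃗_r minor: pairwise disjoint nonempty sets X_1, …, X_r ⊆ V(D) such that for every ordered pair (i, j) with i ≠ j there is an edge of D from X_i to X_j, and at least m of the sets X_i induce strongly connected subdigraphs of D. -/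
open Relation

namespace PSM

variable {V : Type} {Adj : V → V → Prop}

/-- The relation induced on a set. -/
abbrev Ind (Adj : V → V → Prop) (S : Set V) : V → V → Prop :=
  fun a b => a ∈ S ∧ b ∈ S ∧ Adj a b

lemma tmono {R R' : V → V → Prop} {x y : V} (hc : TransGen R x y)
    (h : ∀ a b, R a b → R' a b) : TransGen R' x y := by
  induction hc with
  | single h1 => exact TransGen.single (h _ _ h1)
  | tail _ h1 ih => exact ih.tail (h _ _ h1)

lemma tswap {R R' : V → V → Prop} {x y : V} (hc : TransGen R x y)
    (h : ∀ a b, R a b → R' b a) : TransGen R' y x := by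
  induction hc with
  | single h1 => exact TransGen.single (h _ _ h1)
  | tail _ h1 ih => exact TransGen.head (h _ _ h1) ih

lemma rswap {R R' : V → V → Prop} {x y : V} (hc : ReflTransGen R x y)
    (h : ∀ a b, R a b → R' b a) : ReflTransGen R' y x := by
  induction hc with
  | refl => exact ReflTransGen.refl
  | tail _ h1 ih => exact ReflTransGen.head (h _ _ h1) ih

lemma acyclic_mono {S T : Set V} (h : S ⊆ T) (hT : AcyclicOn Adj T) : AcyclicOn Adj S := by
  intro v hv hc
  exact hT v (h hv) (tmono hc (fun a b hab => ⟨h hab.1, h hab.2.1, hab.2.2⟩))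

/-- If `g` does not increase along edges and all levels are acyclic, the set is acyclic. -/
lemma acyclic_of_levels {S : Set V} (g : V → ℕ)
    (hg : ∀ a ∈ S, ∀ b ∈ S, Adj a b → g b ≤ g a)
    (hl : ∀ i, AcyclicOn Adj {v ∈ S | g v = i}) : AcyclicOn Adj S := by
  intro v hv hc
  have key : ∀ b, TransGen (Ind Adj S) v b →
      g b ≤ g v ∧ (g b = g v → TransGen (Ind Adj {w ∈ S | g w = g v}) v b) := by
    intro b hb
    induction hb with
    | single h =>
      refine ⟨hg _ h.1 _ h.2.1 h.2.2, fun e => TransGen.single ⟨⟨hv, rfl⟩, ⟨h.2.1, e⟩, h.2.2⟩⟩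
    | tail _ h ih =>
      have h1 := hg _ h.1 _ h.2.1 h.2.2
      refine ⟨h1.trans ih.1, fun e => ?_⟩
      have e2 := le_antisymm ih.1 (e ▸ h1)
      exact TransGen.tail (ih.2 e2) ⟨⟨h.1, e2⟩, ⟨h.2.1, e⟩, h.2.2⟩
  exact hl (g v) v ⟨hv, rfl⟩ ((key v hc).2 rfl)

lemma col_of_levels {S : Set V} {k : ℕ} (g : V → ℕ)
    (hg : ∀ a ∈ S, ∀ b ∈ S, Adj a b → g b ≤ g a)
    (hl : ∀ i, DiColorableOn Adj {v ∈ S | g v = i} k) : DiColorableOn Adj S k := by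
  choose c hc1 hc2 using hl
  refine ⟨fun v => c (g v) v, fun v hv => hc1 _ v ⟨hv, rfl⟩, fun i => ?_⟩
  refine acyclic_of_levels g (fun a ha b hb => hg a ha.1 b hb.1) (fun j => ?_)
  refine acyclic_mono ?_ (hc2 j i)
  rintro v ⟨⟨h1, h2⟩, h3⟩
  subst h3
  exact ⟨⟨h1, rfl⟩, h2⟩

lemma col_mono {S : Set V} {k l : ℕ} (h : k ≤ l) (hS : DiColorableOn Adj S k) :
    DiColorableOn Adj S l := by
  obtain ⟨c, h1, h2⟩ := hS
  exact ⟨c, fun v hv => (h1 v hv).trans_le h, h2⟩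

lemma col_union {S : Set V} {k l : ℕ} (p : V → Prop)
    (h1 : DiColorableOn Adj {v ∈ S | p v} k) (h2 : DiColorableOn Adj {v ∈ S | ¬ p v} l) :
    DiColorableOn Adj S (k + l) := by
  classical
  obtain ⟨c, hc, hc'⟩ := h1
  obtain ⟨d, hd, hd'⟩ := h2
  refine ⟨fun v => if p v then c v else k + d v, fun v hv => ?_, fun i => ?_⟩
  · by_cases hp : p v
    · have := hc v ⟨hv, hp⟩
      simp only [hp, if_true]; omega
    · have := hd v ⟨hv, hp⟩
      simp only [hp, if_false]; omega
  · by_cases hi : i < k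
    · refine acyclic_mono ?_ (hc' i)
      rintro v ⟨hv, hvi⟩
      by_cases hp : p v
      · simp only [hp, if_true] at hvi
        exact ⟨⟨hv, hp⟩, hvi⟩
      · simp only [hp, if_false] at hvi
        omega
    · refine acyclic_mono ?_ (hd' (i - k))
      rintro v ⟨hv, hvi⟩
      by_cases hp : p v
      · simp only [hp, if_true] at hvi
        have := hc v ⟨hv, hp⟩
        omega
      · simp only [hp, if_false] at hvi
        exact ⟨⟨hv, hp⟩, by omega⟩

lemma col_layers {S : Set V} {k : ℕ} (f : V → ℕ)
    (hf : ∀ a ∈ S, ∀ b ∈ S, Adj a b → f b ≤ f a + 1)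
    (hl : ∀ i, DiColorableOn Adj {v ∈ S | f v = i} k) : DiColorableOn Adj S (k + k) := by
  have mono : ∀ T : Set V, T ⊆ S → ∀ i, DiColorableOn Adj {v ∈ T | f v = i} k := by
    intro T hT i
    obtain ⟨c, h1, h2⟩ := hl i
    exact ⟨c, fun v hv => h1 v ⟨hT hv.1, hv.2⟩,
      fun j => by
        refine acyclic_mono ?_ (h2 j)
        exact fun v hv => ⟨⟨hT hv.1.1, hv.1.2⟩, hv.2⟩⟩
  refine col_union (fun v => f v % 2 = 0) ?_ ?_
  · refine col_of_levels f ?_ (mono _ fun v hv => hv.1)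
    rintro a ⟨ha, ha'⟩ b ⟨hb, hb'⟩ hab
    have := hf a ha b hb hab
    omega
  · refine col_of_levels f ?_ (mono _ fun v hv => hv.1)
    rintro a ⟨ha, ha'⟩ b ⟨hb, hb'⟩ hab
    have := hf a ha b hb hab
    omega

lemma acyclic_swap {S : Set V} (h : AcyclicOn Adj S) :
    AcyclicOn (fun a b => Adj b a) S := by
  intro v hv hc
  exact h v hv (tswap hc (fun a b hab => ⟨hab.2.1, hab.1, hab.2.2⟩))

lemma col_swap {S : Set V} {k : ℕ} (h : DiColorableOn Adj S k) :
    DiColorableOn (fun a b => Adj b a) S k := by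
  obtain ⟨c, h1, h2⟩ := h
  exact ⟨c, h1, fun i => acyclic_swap (h2 i)⟩

/-- Renaming colours. -/
lemma col_of_finset {S : Set V} (A : Finset ℕ) (c : V → ℕ) (hc : ∀ v ∈ S, c v ∈ A)
    (h : ∀ i, AcyclicOn Adj {v ∈ S | c v = i}) : DiColorableOn Adj S A.card := by
  classical
  refine ⟨fun v => if hv : c v ∈ A then (A.equivFin ⟨c v, hv⟩ : ℕ) else 0, ?_, ?_⟩
  · intro v hv
    simp only [hc v hv, dif_pos]
    exact Fin.is_lt _
  · intro i v hv hcyc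
    refine h (c v) v ⟨hv.1, rfl⟩ (tmono hcyc ?_)
    have key : ∀ a, a ∈ {w ∈ S | (if hw : c w ∈ A then (A.equivFin ⟨c w, hw⟩ : ℕ) else 0) = i} →
        a ∈ {w ∈ S | c w = c v} := by
      rintro a ⟨ha, hai⟩
      refine ⟨ha, ?_⟩
      have hvi := hv.2
      simp only [hc v hv.1, hc a ha, dif_pos] at hai hvi
      have := A.equivFin.injective (Fin.ext (hai.trans hvi.symm))
      simpa using this
    exact fun a b hab => ⟨key a hab.1, key b hab.2.1, hab.2.2⟩

lemma exists_col [Fintype V] (hD : Irreflexive Adj) (S : Set V) :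
    ∃ k, DiColorableOn Adj S k := by
  classical
  refine ⟨Fintype.card V, fun v => Fintype.equivFin V v, fun v _ => Fin.is_lt _, ?_⟩
  intro i v hv hc
  have key : ∀ b, TransGen (Ind Adj {w ∈ S | ((Fintype.equivFin V w : Fin _) : ℕ) = i}) v b →
      False := by
    intro b hb
    induction hb with
    | single h =>
      have : v = _ := (Fintype.equivFin V).injective (Fin.ext (h.1.2.trans h.2.1.2.symm))
      subst this
      exact hD v h.2.2
    | tail _ _ ih => exact ih
  exact key v hc

/-- A partial minor inside `U`. -/
def Minor (Adj : V → V → Prop) (U : Set V) (r m : ℕ) : Prop :=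
  ∃ X : Fin r → Set V, (∀ i, X i ⊆ U) ∧
      (∀ i, (X i).Nonempty) ∧
      (∀ i j, i ≠ j → Disjoint (X i) (X j)) ∧
      (∀ i j, i ≠ j → ∃ u ∈ X i, ∃ w ∈ X j, Adj u w) ∧
      ∃ I : Finset (Fin r), m ≤ I.card ∧
        ∀ i ∈ I, StronglyConnectedOn Adj (X i)

lemma base [Fintype V] (hD : Irreflexive Adj) (U : Set V) (r : ℕ)
    (h : ∀ k < r, ¬ DiColorableOn Adj U k) : Minor Adj U r 0 := by
  classical
  have hex := exists_col hD U
  set k := Nat.find hex with hk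
  obtain ⟨c, hc1, hc2⟩ : DiColorableOn Adj U k := Nat.find_spec hex
  have hmin : ∀ l < k, ¬ DiColorableOn Adj U l := fun l hl => Nat.find_min hex hl
  have hrk : r ≤ k := by
    by_contra hlt
    exact h k (by omega) ⟨c, hc1, hc2⟩
  have hne : ∀ i < k, ∃ v ∈ U, c v = i := by
    intro i hi
    by_contra hcon
    push Not at hcon
    have hcard : ((Finset.range k).erase i).card < k := by
      have := Finset.card_erase_lt_of_mem (Finset.mem_range.2 hi)
      simpa using this
    refine hmin _ hcard (col_of_finset _ c (fun v hv => ?_) hc2)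
    simp [hcon v hv, hc1 v hv]
  have hedge : ∀ i < k, ∀ j < k, i ≠ j →
      ∃ u ∈ {v ∈ U | c v = i}, ∃ w ∈ {v ∈ U | c v = j}, Adj u w := by
    intro i hi j hj hij
    by_contra hcon
    push Not at hcon
    have hcard : ((Finset.range k).erase i).card < k := by
      have := Finset.card_erase_lt_of_mem (Finset.mem_range.2 hi)
      simpa using this
    refine hmin _ hcard (col_of_finset _ (fun v => if c v = i then j else c v)
      (fun v hv => ?_) ?_)
    · by_cases hv' : c v = i
      · simp [hv', hj, hij.symm]
      · simp [hv', hc1 v hv]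
    · intro l
      by_cases hl : l = j
      · subst hl
        refine acyclic_of_levels (fun v => if c v = i then 0 else 1) ?_ ?_
        · rintro a ⟨ha, ha'⟩ b ⟨hb, hb'⟩ hab
          by_cases h1 : c a = i
          · by_cases h2 : c b = i
            · simp [h1, h2]
            · simp only [h2, if_false] at hb'
              exact absurd hab (hcon a ⟨ha, h1⟩ b ⟨hb, hb'⟩)
          · simp only [h1, if_false]
            split_ifs <;> omega
        · intro s
          by_cases hs : s = 0
          · refine acyclic_mono ?_ (hc2 i)
            rintro v ⟨⟨hv, hv1⟩, hv2⟩
            refine ⟨hv, ?_⟩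
            by_contra hne'
            simp only [hne', if_false] at hv2
            omega
          · refine acyclic_mono ?_ (hc2 l)
            rintro v ⟨⟨hv, hv1⟩, hv2⟩
            refine ⟨hv, ?_⟩
            by_cases hne' : c v = i
            · simp only [hne', if_true] at hv2
              omega
            · simpa only [hne', if_false] using hv1
      · refine acyclic_mono ?_ (hc2 l)
        rintro v ⟨hv, hv1⟩
        refine ⟨hv, ?_⟩
        by_cases hne' : c v = i
        · simp only [hne', if_true] at hv1
          omega
        · simpa only [hne', if_false] using hv1
  refine ⟨fun i => {v ∈ U | c v = i}, fun i v hv => hv.1, fun i => ?_, fun i j hij => ?_,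
    fun i j hij => ?_, ∅, by simp, by simp⟩
  · obtain ⟨v, hv, hv'⟩ := hne i (i.2.trans_le hrk)
    exact ⟨v, hv, hv'⟩
  · rw [Set.disjoint_left]
    rintro v ⟨_, h1⟩ ⟨_, h2⟩
    exact hij (Fin.ext (h1.symm.trans h2))
  · exact hedge i (i.2.trans_le hrk) j (j.2.trans_le hrk) (fun e => hij (Fin.ext e))

/-- A non-`k`-colourable set contains a strongly connected non-`k`-colourable set. -/
lemma exists_strong [Fintype V] (k : ℕ) :
    ∀ n, ∀ U : Set V, U.ncard = n → ¬ DiColorableOn Adj U k →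
    ∃ W ⊆ U, StronglyConnectedOn Adj W ∧ ¬ DiColorableOn Adj W k := by
  intro n
  induction n using Nat.strong_induction_on with
  | _ n ih =>
    intro U hn hU
    by_cases hs : StronglyConnectedOn Adj U
    · exact ⟨U, subset_rfl, hs, hU⟩
    by_contra hcon
    have hsub : ∀ W ⊂ U, DiColorableOn Adj W k := by
      intro W hW
      by_contra hWk
      obtain ⟨W', h1, h2⟩ := ih W.ncard (hn ▸ Set.ncard_lt_ncard hW (Set.toFinite _)) W rfl hWk
      exact hcon ⟨W', h1.trans hW.1, h2⟩
    apply hs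
    intro u hu v hv
    by_contra huv
    classical
    refine hU (col_of_levels (fun w => if ReflTransGen (Ind Adj U) u w then 0 else 1) ?_ ?_)
    · intro a ha b hb hab
      by_cases h1 : ReflTransGen (Ind Adj U) u a
      · have h2 : ReflTransGen (Ind Adj U) u b := h1.tail ⟨ha, hb, hab⟩
        simp [h1, h2]
      · simp only [h1, if_false]
        split_ifs <;> omega
    · intro i
      apply hsub
      refine ⟨fun w hw => hw.1, fun hcon2 => ?_⟩
      have e1 := (hcon2 hu).2
      have e2 := (hcon2 hv).2
      have e3 : ReflTransGen (Ind Adj U) u u := ReflTransGen.refl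
      simp only [e3, if_true] at e1
      rw [if_neg huv] at e2
      omega

/-- Existence of walks of length `n`. -/
def Walk (R : V → V → Prop) (v : V) : ℕ → V → Prop
  | 0, w => w = v
  | n + 1, w => ∃ u, Walk R v n u ∧ R u w

lemma walk_of_rtg {R : V → V → Prop} {v w : V} (h : ReflTransGen R v w) : ∃ n, Walk R v n w := by
  induction h with
  | refl => exact ⟨0, rfl⟩
  | tail _ h ih =>
    obtain ⟨n, hn⟩ := ih
    exact ⟨n + 1, _, hn, h⟩

/-- Breadth-first-search layering. -/
lemma bfs (U : Set V) (v : V)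
    (h : ∀ w ∈ U, ReflTransGen (Ind Adj U) v w) :
    ∃ f : V → ℕ, (∀ a ∈ U, ∀ b ∈ U, Adj a b → f b ≤ f a + 1) ∧ f v = 0 ∧
      (∀ w ∈ U, f w = 0 → w = v) ∧
      (∀ w ∈ U, ∀ n, f w = n + 1 → ∃ u ∈ U, f u = n ∧ Adj u w) := by
  classical
  have hex : ∀ w ∈ U, ∃ n, Walk (Ind Adj U) v n w := fun w hw => walk_of_rtg (h w hw)
  let f : V → ℕ := fun w => sInf {n | Walk (Ind Adj U) v n w}
  have hle : ∀ w n, Walk (Ind Adj U) v n w → f w ≤ n := fun w n hn => Nat.sInf_le hn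
  have hmem : ∀ w ∈ U, Walk (Ind Adj U) v (f w) w := fun w hw => Nat.sInf_mem (hex w hw)
  have hstep : ∀ a ∈ U, ∀ b ∈ U, Adj a b → f b ≤ f a + 1 := fun a ha b hb hab =>
    hle b _ ⟨a, hmem a ha, ha, hb, hab⟩
  refine ⟨f, hstep, ?_, ?_, ?_⟩
  · have := hle v 0 rfl
    omega
  · intro w hw h0
    have := hmem w hw
    rw [h0] at this
    exact this
  · intro w hw n hn
    have := hmem w hw
    rw [hn] at this
    obtain ⟨u, hu1, hu2, -, hu3⟩ := this
    have h1 := hle u n hu1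
    have h2 := hstep u hu2 w hw hu3
    exact ⟨u, hu2, by omega, hu3⟩

lemma reach (U Y T : Set V) (v : V) (f : V → ℕ) (i : ℕ)
    (h0 : ∀ w ∈ U, f w = 0 → w = v)
    (h1 : ∀ w ∈ U, ∀ n, f w = n + 1 → ∃ u ∈ U, f u = n ∧ Adj u w)
    (hT : ∀ w ∈ U, f w < i → w ∈ T) (hY : Y ⊆ T) (hYU : Y ⊆ U) (hYi : ∀ w ∈ Y, f w = i) :
    ∀ w ∈ Y, ReflTransGen (Ind Adj T) v w := by
  have key : ∀ n, ∀ w ∈ U, f w = n → (n < i ∨ w ∈ Y) → ReflTransGen (Ind Adj T) v w := by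
    intro n
    induction n with
    | zero =>
      intro w hw hfw _
      rw [h0 w hw hfw]
    | succ n ih =>
      intro w hw hfw hor
      obtain ⟨u, hu, hfu, hadj⟩ := h1 w hw n hfw
      have hni : n < i := by
        rcases hor with h | h
        · omega
        · have := hYi w h
          omega
      refine (ih u hu hfu (Or.inl hni)).tail ⟨hT u hu (by omega), ?_, hadj⟩
      rcases hor with h | h
      · exact hT w hw (by omega)
      · exact hY h
  intro w hw
  exact key _ w (hYU hw) rfl (Or.inr hw)

lemma scc_strong (T : Set V) (v : V) :
    StronglyConnectedOn Adj
      {w | ReflTransGen (Ind Adj T) v w ∧ ReflTransGen (Ind Adj T) w v} := by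
  intro a ha b hb
  have hab : ReflTransGen (Ind Adj T) a b := ha.2.trans hb.1
  induction hab using ReflTransGen.head_induction_on with
  | refl => exact ReflTransGen.refl
  | head h1 h2 ih =>
    have hc : _ ∈ {w | ReflTransGen (Ind Adj T) v w ∧ ReflTransGen (Ind Adj T) w v} :=
      ⟨ha.1.tail h1, h2.trans hb.2⟩
    exact ReflTransGen.head ⟨ha, hc, h1.2.2⟩ (ih hc)

lemma main [Fintype V] (hD : Irreflexive Adj) (r : ℕ) (hr : 1 ≤ r) (m : ℕ) (hm : m ≤ r) :
    ∀ U : Set V, ¬ DiColorableOn Adj U (r * 4 ^ m - 1) → Minor Adj U r m := by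
  classical
  induction m with
  | zero =>
    intro U hU
    refine base hD U r (fun k hk hc => hU (col_mono ?_ hc))
    simp; omega
  | succ m ih =>
    intro U₀ hU₀
    obtain ⟨U, hUU, hstr, hU⟩ := exists_strong _ _ U₀ rfl hU₀
    have hne : U.Nonempty := by
      by_contra hemp
      rw [Set.not_nonempty_iff_eq_empty] at hemp
      subst hemp
      exact hU ⟨fun _ => 0, by simp, fun i v hv => absurd hv.1 (by simp)⟩
    obtain ⟨v, hv⟩ := hne
    obtain ⟨f, hf1, hfv, hf0, hfs⟩ := bfs (Adj := Adj) U v (fun w hw => hstr hv hw)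
    obtain ⟨g, hg1, hgv, hg0, hgs⟩ := bfs (Adj := fun a b => Adj b a) U v (fun w hw =>
      rswap (hstr hw hv) (fun a b hab => ⟨hab.2.1, hab.1, hab.2.2⟩))
    obtain ⟨i, j, hS⟩ : ∃ i j, ¬ DiColorableOn Adj {w ∈ {w ∈ U | f w = i} | g w = j}
        (r * 4 ^ m - 1) := by
      by_contra hcon
      push Not at hcon
      refine hU (col_mono ?_ (col_layers (k := (r * 4 ^ m - 1) + (r * 4 ^ m - 1))
        f hf1 (fun i => ?_)))
      · have : r * 4 ^ (m + 1) = 4 * (r * 4 ^ m) := by ring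
        omega
      · have := col_layers (Adj := fun a b => Adj b a) (S := {w ∈ U | f w = i}) g
          (fun a ha b hb => hg1 a ha.1 b hb.1) (fun j => col_swap (hcon i j))
        exact col_swap this
    set S : Set V := {w ∈ {w ∈ U | f w = i} | g w = j} with hSdef
    obtain ⟨X, hXS, hXne, hXd, hXe, I, hI, hIs⟩ := ih (by omega) S hS
    have hSU : S ⊆ U := fun w hw => hw.1.1
    by_cases hall : ∀ a, a ∈ I
    · refine ⟨X, fun a => (hXS a).trans (hSU.trans hUU), hXne, hXd, hXe, I, ?_, hIs⟩
      rw [Finset.eq_univ_iff_forall.2 hall]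
      simpa using hm
    push Not at hall
    obtain ⟨a, ha⟩ := hall
    set T : Set V := X a ∪ (U \ S) with hT
    set Y : Set V := {w | ReflTransGen (Ind Adj T) v w ∧ ReflTransGen (Ind Adj T) w v} with hY
    have hXU : X a ⊆ U := (hXS a).trans hSU
    have hXY : X a ⊆ Y := by
      intro w hw
      constructor
      · refine reach U (X a) T v f i hf0 hfs ?_ (fun _ h => Or.inl h) hXU
          (fun w hw => (hXS a hw).1.2) w hw
        intro w hw hlt
        exact Or.inr ⟨hw, fun hwS => absurd hwS.1.2 (by omega)⟩
      · have := reach (Adj := fun a b => Adj b a) U (X a) T v g j hg0 hgs ?_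
          (fun _ h => Or.inl h) hXU (fun w hw => (hXS a hw).2) w hw
        · exact rswap this (fun a b hab => ⟨hab.2.1, hab.1, hab.2.2⟩)
        · intro w hw hlt
          exact Or.inr ⟨hw, fun hwS => absurd hwS.2 (by omega)⟩
    have hvT : v ∈ T := by
      by_cases hvS : v ∈ S
      · obtain ⟨y, hy⟩ := hXne a
        have h1 := (hXS a hy).1.2
        have h2 := hvS.1.2
        have : y = v := hf0 y (hXU hy) (by omega)
        exact Or.inl (this ▸ hy)
      · exact Or.inr ⟨hv, hvS⟩
    have hYT : Y ⊆ T := by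
      rintro w ⟨hw, -⟩
      rcases ReflTransGen.cases_tail hw with h | ⟨c, -, h⟩
      · exact h ▸ hvT
      · exact h.2.1
    have hYd : ∀ b, b ≠ a → Disjoint Y (X b) := by
      intro b hb
      rw [Set.disjoint_left]
      intro w hw hwb
      rcases hYT hw with h | h
      · exact Set.disjoint_left.1 (hXd b a hb) hwb h
      · exact h.2 (hXS b hwb)
    have hsub : ∀ b, X b ⊆ Function.update X a Y b := by
      intro b
      by_cases hb : b = a
      · subst hb; simpa using hXY
      · simp [Function.update_of_ne hb]
    refine ⟨Function.update X a Y, ?_, ?_, ?_, ?_, insert a I, ?_, ?_⟩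
    · intro b
      by_cases hb : b = a
      · subst hb
        rw [Function.update_self]
        exact hYT.trans ((Set.union_subset hXU Set.sdiff_subset).trans hUU)
      · rw [Function.update_of_ne hb]
        exact (hXS b).trans (hSU.trans hUU)
    · exact fun b => (hXne b).mono (hsub b)
    · intro b c hbc
      by_cases hb : b = a
      · subst hb
        rw [Function.update_self, Function.update_of_ne hbc.symm]
        exact hYd c hbc.symm
      · rw [Function.update_of_ne hb]
        by_cases hc : c = a
        · subst hc
          rw [Function.update_self]
          exact (hYd b hb).symm
        · rw [Function.update_of_ne hc]
          exact hXd b c hbc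
    · intro b c hbc
      obtain ⟨u, hu, w, hw, huw⟩ := hXe b c hbc
      exact ⟨u, hsub b hu, w, hsub c hw, huw⟩
    · rw [Finset.card_insert_of_notMem ha]
      omega
    · intro b hb
      by_cases hba : b = a
      · subst hba
        rw [Function.update_self]
        exact scc_strong T v
      · rw [Function.update_of_ne hba]
        exact hIs b ((Finset.mem_insert.1 hb).resolve_left hba)

end PSM

/-- every digraph with dichromatic number at least `r * 4 ^ m`
(`1 ≤ r`, `m ≤ r`) contains an `m`-partial strong `K⃗ r` minor: pairwise
disjoint nonempty sets `X 1, …, X r` with an edge from `X i` to `X j` for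
every ordered pair `(i, j)` with `i ≠ j`, at least `m` of which induce
strongly connected subdigraphs. -/
theorem digraph_contains_partial_strong_minor
    {V : Type} [Fintype V] (Adj : V → V → Prop) (hD : Irreflexive Adj)
    (r m : ℕ) (hr : 1 ≤ r) (hm : m ≤ r)
    (hchi : r * 4 ^ m ≤ dichromaticNumberOn Adj Set.univ) :
    ∃ X : Fin r → Set V,
      (∀ i, (X i).Nonempty) ∧
      (∀ i j, i ≠ j → Disjoint (X i) (X j)) ∧
      (∀ i j, i ≠ j → ∃ u ∈ X i, ∃ w ∈ X j, Adj u w) ∧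
      ∃ I : Finset (Fin r), m ≤ I.card ∧
        ∀ i ∈ I, StronglyConnectedOn Adj (X i) := by
  obtain ⟨X, -, h⟩ := PSM.main hD r hr m hm Set.univ (fun hc => by
    have h1 : dichromaticNumberOn Adj Set.univ ≤ r * 4 ^ m - 1 := Nat.sInf_le hc
    have h2 : 0 < r * 4 ^ m := by positivity
    omega)
  exact ⟨X, h⟩
end

section
/- Let T be a tournament and let P be a shortest directed path in T from a vertex u to a vertex v (i.e. no directed path in T from u to v has fewer vertices). Then the subtournament of T induced by the vertex set of P has dichromatic number at most 2. -/
/-- the vertex set of a shortest directed path from `u` to `v`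
in a tournament induces a subtournament of dichromatic number at most `2`. -/
theorem shortest_path_in_tournament_chi_le_two
    {V : Type} [Fintype V] (Adj : V → V → Prop) (hT : IsTournament Adj)
    (u v : V) (n : ℕ) (p : Fin (n + 1) → V)
    (hinj : Function.Injective p)
    (h0 : p 0 = u) (hlast : p (Fin.last n) = v)
    (hadj : ∀ i : Fin n, Adj (p i.castSucc) (p i.succ))
    (hmin : ∀ (m : ℕ) (q : Fin (m + 1) → V), Function.Injective q →
      q 0 = u → q (Fin.last m) = v →
      (∀ i : Fin m, Adj (q i.castSucc) (q i.succ)) → n ≤ m) :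
    dichromaticNumberOn Adj (Set.range p) ≤ 2 := by
  classical
  -- no forward edge skips a vertex of the path
  have key : ∀ i j : Fin (n + 1), i.val + 2 ≤ j.val → ¬ Adj (p i) (p j) := by
    intro i j hij hA
    have hj := j.isLt
    obtain ⟨d, hd⟩ : ∃ d, j.val = i.val + 1 + d := ⟨j.val - i.val - 1, by omega⟩
    obtain ⟨m, hm⟩ : ∃ m, n = m + d := ⟨n - d, by omega⟩
    have hlt : ∀ k : Fin (m + 1), (if k.val ≤ i.val then k.val else k.val + d) < n + 1 := by
      intro k
      have := k.isLt
      split_ifs <;> omega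
    have hle := hmin m (fun k => p ⟨if k.val ≤ i.val then k.val else k.val + d, hlt k⟩)
      (by
        intro a b hab
        have h := congrArg Fin.val (hinj hab)
        simp only at h
        apply Fin.ext
        split_ifs at h <;> omega)
      (by
        rw [← h0]
        congr 1)
      (by
        rw [← hlast]
        congr 1
        apply Fin.ext
        simp only [Fin.val_last]
        split_ifs <;> omega)
      (by
        intro k
        have hk := k.isLt
        simp only [Fin.val_castSucc, Fin.val_succ]
        by_cases h1 : k.val + 1 ≤ i.val
        · have e := hadj ⟨k.val, by omega⟩
          convert e using 2
          · apply Fin.ext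
            simp only [Fin.val_castSucc]
            split_ifs <;> omega
          · apply Fin.ext
            simp only [Fin.val_succ]
            split_ifs <;> omega
        · by_cases h2 : k.val = i.val
          · convert hA using 2
            · apply Fin.ext
              simp only
              split_ifs <;> omega
            · apply Fin.ext
              simp only
              split_ifs <;> omega
          · have e := hadj ⟨k.val + d, by omega⟩
            convert e using 2
            · apply Fin.ext
              simp only [Fin.val_castSucc]
              split_ifs <;> omega
            · apply Fin.ext
              simp only [Fin.val_succ]
              split_ifs <;> omega)
    omega
  have hinv : ∀ i, Function.invFun p (p i) = i := Function.leftInverse_invFun hinj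
  -- colour by the parity of the index along the path
  apply Nat.sInf_le
  refine ⟨fun x => (Function.invFun p x).val % 2, fun x _ => Nat.mod_lt _ (by norm_num), ?_⟩
  intro c x _ hcyc
  have step : ∀ a b, Relation.TransGen (fun a b =>
      a ∈ {v ∈ Set.range p | (Function.invFun p v).val % 2 = c} ∧
      b ∈ {v ∈ Set.range p | (Function.invFun p v).val % 2 = c} ∧ Adj a b) a b →
      (Function.invFun p b).val < (Function.invFun p a).val := by
    have one : ∀ a b, (a ∈ {v ∈ Set.range p | (Function.invFun p v).val % 2 = c} ∧
        b ∈ {v ∈ Set.range p | (Function.invFun p v).val % 2 = c} ∧ Adj a b) →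
        (Function.invFun p b).val < (Function.invFun p a).val := by
      rintro _ _ ⟨⟨⟨i, rfl⟩, hi⟩, ⟨⟨j, rfl⟩, hj⟩, hA⟩
      rw [hinv] at hi hj
      rw [hinv, hinv]
      by_contra hlt
      have hne : i.val ≠ j.val := by
        intro h
        rw [Fin.ext h] at hA
        exact hT.1 _ hA
      exact key i j (by omega) hA
    intro a b h
    induction h with
    | single h => exact one _ _ h
    | tail _ h ih => exact (one _ _ h).trans ih
  exact lt_irrefl _ (step x x hcyc)
end
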